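/- There exists a constant C > 0 such that every n-dimensional symmetric convex body K (n ≥ 2) admits a subquotient (a slice of a projection) of dimension at least C·n/log n that is 256-round. -/

import Mathlib

open MeasureTheory Pointwise

/-- An ellipsoid: the image of the closed Euclidean unit ball under a linear bijection. -/
def IsEllipsoid {V : Type*} [AddCommGroup V] [Module ℝ V] (E : Set V) : Prop :=
  ∃ (m : ℕ) (L : EuclideanSpace ℝ (Fin m) →ₗ[ℝ] V), Function.Bijective L ∧
    E = L '' Metric.closedBall 0 1

section Gaussian

open ProbabilityTheory Real
open scoped RealInnerProductSpace ENNReal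

variable {V : Type*} [NormedAddCommGroup V] [InnerProductSpace ℝ V]

variable (V) in
/-- The density of the standard Gaussian measure with respect to Lebesgue measure. -/
noncomputable def gaussianDensity (v : V) : ℝ :=
  ((2 * π) ^ (Module.finrank ℝ V / 2 : ℝ))⁻¹ * rexp (-(1 / 2) * ‖v‖ ^ 2)

lemma gaussianDensity_nonneg (v : V) : 0 ≤ gaussianDensity V v := by
  unfold gaussianDensity; positivity

lemma continuous_gaussianDensity : Continuous (gaussianDensity V) := by
  unfold gaussianDensity; fun_prop

variable [FiniteDimensional ℝ V] [MeasurableSpace V] [BorelSpace V]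

lemma integral_gaussianDensity : ∫ v, gaussianDensity V v = 1 := by
  unfold gaussianDensity
  rw [integral_const_mul, GaussianFourier.integral_rexp_neg_mul_sq_norm (by norm_num)]
  rw [show π / (1 / 2) = 2 * π by ring]
  exact inv_mul_cancel₀ (by positivity)

lemma integrable_gaussianDensity : Integrable (gaussianDensity V) := by
  by_contra h
  have := integral_gaussianDensity (V := V)
  rw [integral_undef h] at this
  norm_num at this

lemma stdGaussian_eq_withDensity :
    stdGaussian V = volume.withDensity (fun v ↦ ENNReal.ofReal (gaussianDensity V v)) := by
  have : IsFiniteMeasure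
      ((volume : Measure V).withDensity (fun v ↦ ENNReal.ofReal (gaussianDensity V v))) :=
    isFiniteMeasure_withDensity_ofReal integrable_gaussianDensity.2
  refine Measure.ext_of_charFun ?_
  ext t
  rw [charFun_stdGaussian, charFun_apply,
    integral_withDensity_eq_integral_toReal_smul₀ (by
      exact (continuous_gaussianDensity.measurable.ennreal_ofReal).aemeasurable) (by simp)]
  have h := GaussianFourier.integral_cexp_neg_mul_sq_norm_add (V := V) (b := 1 / 2) (by norm_num) Complex.I t
  have h2 : ∀ v : V, (ENNReal.ofReal (gaussianDensity V v)).toReal •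
      Complex.exp (⟪v, t⟫ * Complex.I) = (((2 * π) ^ (Module.finrank ℝ V / 2 : ℝ))⁻¹ : ℝ) *
        Complex.exp (-(1 / 2) * ‖v‖ ^ 2 + Complex.I * ⟪t, v⟫) := by
    intro v
    rw [ENNReal.toReal_ofReal (gaussianDensity_nonneg v), gaussianDensity, Complex.real_smul,
      Complex.exp_add, real_inner_comm, mul_comm Complex.I]
    push_cast
    ring
  simp_rw [h2]
  rw [integral_const_mul, h, ← mul_assoc]
  have h3 : (((2 * π) ^ (Module.finrank ℝ V / 2 : ℝ))⁻¹ : ℝ) *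
      ((π : ℂ) / (1 / 2)) ^ (Module.finrank ℝ V / 2 : ℂ) = 1 := by
    rw [show (π : ℂ) / (1 / 2) = ((2 * π : ℝ) : ℂ) by push_cast; ring]
    rw [show (Module.finrank ℝ V / 2 : ℂ) = ((Module.finrank ℝ V / 2 : ℝ) : ℂ) by push_cast; rfl]
    rw [← Complex.ofReal_cpow (by positivity), ← Complex.ofReal_mul]
    rw [inv_mul_cancel₀ (by positivity)]
    simp
  rw [h3, one_mul, Complex.I_sq]
  congr 1
  ring

/-- Translating a symmetric set by `x` costs at most a factor `exp (-‖x‖² / 2)` of Gaussian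
measure. -/
lemma exp_mul_stdGaussian_le_translate {A : Set V} (hA : MeasurableSet A) (hs : ∀ v ∈ A, -v ∈ A)
    (x : V) : rexp (-‖x‖ ^ 2 / 2) * (stdGaussian V).real A ≤
      (stdGaussian V).real {v | v - x ∈ A} := by
  have hreal : ∀ B : Set V, MeasurableSet B →
      (stdGaussian V).real B = ∫ v in B, gaussianDensity V v := by
    intro B hB
    rw [measureReal_def, stdGaussian_eq_withDensity, withDensity_apply _ hB,
      integral_eq_lintegral_of_nonneg_ae (ae_of_all _ gaussianDensity_nonneg)
        continuous_gaussianDensity.aestronglyMeasurable]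
  have hB : MeasurableSet {v | v - x ∈ A} := (measurable_sub_const x) hA
  rw [hreal A hA, hreal _ hB, ← integral_indicator hA, ← integral_indicator hB]
  set ρ := gaussianDensity V
  have hi : Integrable ρ := integrable_gaussianDensity
  have e1 : ∫ v, {v | v - x ∈ A}.indicator ρ v = ∫ v, A.indicator (fun v ↦ ρ (v + x)) v := by
    rw [← integral_add_right_eq_self _ x]
    congr 1 with v
    have hv' : v + x ∈ {v | v - x ∈ A} ↔ v ∈ A := by simp
    by_cases hv : v ∈ A
    · rw [Set.indicator_of_mem hv, Set.indicator_of_mem (hv'.2 hv)]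
    · rw [Set.indicator_of_notMem hv, Set.indicator_of_notMem (hv'.not.2 hv)]
  have e2 : ∫ v, A.indicator (fun v ↦ ρ (v + x)) v = ∫ v, A.indicator (fun v ↦ ρ (v - x)) v := by
    rw [← integral_neg_eq_self]
    congr 1 with v
    have : -v ∈ A ↔ v ∈ A := ⟨fun h ↦ by simpa using hs _ h, hs v⟩
    have hρ : ρ (-v + x) = ρ (v - x) := by
      simp only [ρ, gaussianDensity]
      rw [← norm_neg (-v + x), neg_add, neg_neg, sub_eq_add_neg]
    by_cases hv : v ∈ A
    · rw [Set.indicator_of_mem hv, Set.indicator_of_mem (this.2 hv), hρ]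
    · rw [Set.indicator_of_notMem hv, Set.indicator_of_notMem (this.not.2 hv)]
  have i1 : Integrable (A.indicator (fun v ↦ ρ (v + x))) := (hi.comp_add_right x).indicator hA
  have i2 : Integrable (A.indicator (fun v ↦ ρ (v - x))) := (hi.comp_sub_right x).indicator hA
  have e3 : ∫ v, {v | v - x ∈ A}.indicator ρ v =
      ∫ v, (1 / 2) * (A.indicator (fun v ↦ ρ (v + x)) v + A.indicator (fun v ↦ ρ (v - x)) v) := by
    rw [integral_const_mul, integral_add i1 i2, ← e2, ← e1]; ring
  rw [e3, ← integral_const_mul]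
  refine integral_mono ((hi.indicator hA).const_mul _) ((i1.add i2).const_mul _) fun v ↦ ?_
  simp only [Set.indicator]
  split_ifs
  · simp only [ρ, gaussianDensity]
    have key : ∀ s : ℝ, rexp (-(1 / 2) * (‖v‖ ^ 2 + ‖x‖ ^ 2 + s)) =
        rexp (-‖x‖ ^ 2 / 2) * rexp (-(1 / 2) * ‖v‖ ^ 2) * rexp (-(s / 2)) := by
      intro s; rw [← Real.exp_add, ← Real.exp_add]; congr 1; ring
    have n1 : ‖v + x‖ ^ 2 = ‖v‖ ^ 2 + ‖x‖ ^ 2 + 2 * ⟪v, x⟫ := by rw [norm_add_sq_real]; ring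
    have n2 : ‖v - x‖ ^ 2 = ‖v‖ ^ 2 + ‖x‖ ^ 2 + -(2 * ⟪v, x⟫) := by rw [norm_sub_sq_real]; ring
    rw [n1, n2, key, key]
    have hc : 2 ≤ rexp (-(2 * ⟪v, x⟫ / 2)) + rexp (-(-(2 * ⟪v, x⟫) / 2)) := by
      have := Real.one_le_cosh ⟪v, x⟫
      rw [Real.cosh_eq] at this
      rw [show -(2 * ⟪v, x⟫ / 2) = -⟪v, x⟫ by ring, show -(-(2 * ⟪v, x⟫) / 2) = ⟪v, x⟫ by ring]
      linarith
    have hp : 0 ≤ ((2 * π) ^ (Module.finrank ℝ V / 2 : ℝ))⁻¹ *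
      (rexp (-‖x‖ ^ 2 / 2) * rexp (-(1 / 2) * ‖v‖ ^ 2)) := by positivity
    nlinarith [mul_le_mul_of_nonneg_left hc hp]
  · simp

lemma map_inner_stdGaussian (y : V) :
    (stdGaussian V).map (fun v ↦ ⟪y, v⟫) = gaussianReal 0 (‖y‖₊ ^ 2) := by
  have := IsGaussian.map_eq_gaussianReal (μ := stdGaussian V) (innerSL ℝ y)
  rw [variance_dual_stdGaussian, integral_strongDual_stdGaussian, innerSL_apply_norm] at this
  rw [show ‖y‖₊ ^ 2 = (‖y‖ ^ 2).toNNReal by ext; simp]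
  exact this

lemma integral_exp_inner_stdGaussian (y : V) :
    ∫ v, rexp ⟪y, v⟫ ∂(stdGaussian V) = rexp (‖y‖ ^ 2 / 2) := by
  have := mgf_gaussianReal (map_inner_stdGaussian y) 1
  simpa [mgf] using this

lemma integrable_exp_inner_stdGaussian (y : V) :
    Integrable (fun v ↦ rexp ⟪y, v⟫) (stdGaussian V) := by
  by_contra h
  have := integral_exp_inner_stdGaussian y
  rw [integral_undef h] at this
  exact (Real.exp_pos _).ne this

lemma integral_exp_mul_sq_gaussianReal {s : ℝ} (hs : s < 1 / 2) :
    ∫ x, rexp (s * x ^ 2) ∂(gaussianReal 0 1) = (√(1 - 2 * s))⁻¹ := by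
  rw [integral_gaussianReal_eq_integral_smul (by norm_num)]
  simp only [gaussianPDFReal, smul_eq_mul, sub_zero, NNReal.coe_one, mul_one]
  have : ∀ x : ℝ, (√(2 * π))⁻¹ * rexp (-x ^ 2 / 2) * rexp (s * x ^ 2) =
      (√(2 * π))⁻¹ * rexp (-(1 / 2 - s) * x ^ 2) := by
    intro x; rw [mul_assoc, ← Real.exp_add]; congr 2; ring
  simp_rw [this]
  rw [integral_const_mul, integral_gaussian, ← Real.sqrt_inv, ← Real.sqrt_inv,
    ← Real.sqrt_mul (by positivity)]
  congr 1
  have : (1 : ℝ) / 2 - s ≠ 0 := by linarith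
  have : (1 : ℝ) - 2 * s ≠ 0 := by linarith
  field_simp

lemma map_inner_stdGaussian_of_norm_eq_one {y : V} (hy : ‖y‖ = 1) :
    (stdGaussian V).map (fun v ↦ ⟪y, v⟫) = gaussianReal 0 1 := by
  rw [map_inner_stdGaussian]
  congr 1
  ext; simp [hy]

lemma integral_exp_mul_inner_sq_stdGaussian {y : V} (hy : ‖y‖ = 1) {s : ℝ} (hs : s < 1 / 2) :
    ∫ v, rexp (s * ⟪y, v⟫ ^ 2) ∂(stdGaussian V) = (√(1 - 2 * s))⁻¹ := by
  rw [← integral_exp_mul_sq_gaussianReal hs, ← map_inner_stdGaussian_of_norm_eq_one hy,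
    integral_map (by fun_prop) (by fun_prop)]

lemma integral_inner_sq_stdGaussian (y : V) :
    ∫ v, ⟪y, v⟫ ^ 2 ∂(stdGaussian V) = ‖y‖ ^ 2 := by
  have h := variance_dual_stdGaussian (innerSL ℝ y)
  rw [variance_eq_integral (by fun_prop), integral_strongDual_stdGaussian] at h
  simpa using h

lemma integrable_norm_sq_stdGaussian : Integrable (fun v ↦ ‖v‖ ^ 2) (stdGaussian V) := by
  have := (IsGaussian.memLp_two_id (μ := stdGaussian V))
  exact this.integrable_norm_pow (by norm_num)

lemma integral_norm_sq_stdGaussian :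
    ∫ v, ‖v‖ ^ 2 ∂(stdGaussian V) = Module.finrank ℝ V := by
  have : ∀ v : V, ‖v‖ ^ 2 = ∑ i, ⟪stdOrthonormalBasis ℝ V i, v⟫ ^ 2 := fun v ↦
    ((stdOrthonormalBasis ℝ V).sum_sq_inner_right v).symm
  simp_rw [this]
  rw [integral_finsetSum]
  · simp [integral_inner_sq_stdGaussian]
  · intro i _
    refine (integrable_norm_sq_stdGaussian (V := V)).mono' (by fun_prop) (ae_of_all _ fun v ↦ ?_)
    rw [Real.norm_of_nonneg (sq_nonneg _)]
    have := abs_real_inner_le_norm (stdOrthonormalBasis ℝ V i) v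
    rw [(stdOrthonormalBasis ℝ V).norm_eq_one, one_mul] at this
    exact sq_le_sq' (by linarith [abs_le.1 this]) (abs_le.1 this).2

end Gaussian

section Nets

open ProbabilityTheory Real
open scoped RealInnerProductSpace ENNReal

variable {V : Type*} [NormedAddCommGroup V] [InnerProductSpace ℝ V] [FiniteDimensional ℝ V]

lemma Seminorm.continuous_of_finiteDimensional' (N : Seminorm ℝ V) : Continuous N :=
  (ConvexOn.locallyLipschitz N.convexOn).continuous

lemma Seminorm.exists_le_mul_norm (N : Seminorm ℝ V) : ∃ C : ℝ, 0 < C ∧ ∀ x, N x ≤ C * ‖x‖ :=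
  N.bound_of_continuous_normedSpace N.continuous_of_finiteDimensional'

variable [MeasurableSpace V] [BorelSpace V]

lemma Seminorm.integrable_sq_stdGaussian (N : Seminorm ℝ V) :
    Integrable (fun v ↦ N v ^ 2) (stdGaussian V) := by
  obtain ⟨C, hC, h⟩ := N.exists_le_mul_norm
  refine ((integrable_norm_sq_stdGaussian (V := V)).const_mul (C ^ 2)).mono'
    (N.continuous_of_finiteDimensional'.pow 2).aestronglyMeasurable (ae_of_all _ fun v ↦ ?_)
  rw [Real.norm_of_nonneg (sq_nonneg _), ← mul_pow]
  exact pow_le_pow_left₀ (apply_nonneg N v) (h v) 2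

lemma card_le_of_separated (N : Seminorm ℝ V) {ℓ r s : ℝ} (hℓ : 0 < ℓ) (hs : 0 < s)
    (hN : ∫ v, N v ^ 2 ∂(stdGaussian V) ≤ ℓ ^ 2) (T : Finset V) (hT : ∀ x ∈ T, ‖x‖ ≤ r)
    (hsep : ∀ x ∈ T, ∀ y ∈ T, x ≠ y → s < N (x - y)) :
    (T.card : ℝ) ≤ 2 * rexp (8 * r ^ 2 * ℓ ^ 2 / s ^ 2) := by
  set A : Set V := {v | N v ≤ 2 * ℓ} with hAdef
  have hA : MeasurableSet A :=
    (isClosed_le N.continuous_of_finiteDimensional' continuous_const).measurableSet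
  have hsymm : ∀ v ∈ A, -v ∈ A := fun v hv ↦ by simpa [hAdef] using hv
  have hγA : 1 / 2 ≤ (stdGaussian V).real A := by
    have h1 := mul_meas_ge_le_integral_of_nonneg (μ := stdGaussian V) (f := fun v ↦ N v ^ 2)
      (ae_of_all _ fun v ↦ sq_nonneg _) N.integrable_sq_stdGaussian (4 * ℓ ^ 2)
    have h2 : (stdGaussian V).real Aᶜ ≤ (stdGaussian V).real {x | 4 * ℓ ^ 2 ≤ N x ^ 2} := by
      refine measureReal_mono fun v hv ↦ ?_
      have hv' : 2 * ℓ < N v := by simpa [hAdef] using hv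
      show 4 * ℓ ^ 2 ≤ N v ^ 2
      nlinarith
    rw [probReal_compl_eq_one_sub hA] at h2
    have h3 : (stdGaussian V).real {x | 4 * ℓ ^ 2 ≤ N x ^ 2} ≤ 1 / 4 := by
      have : 0 < ℓ ^ 2 := by positivity
      nlinarith
    linarith
  set l := 4 * ℓ / s with hl
  have hlpos : 0 < l := by positivity
  set B : V → Set V := fun x ↦ {v | v - l • x ∈ A}
  have hBm : ∀ x, MeasurableSet (B x) := fun x ↦ (measurable_sub_const (l • x)) hA
  have hdisj : (T : Set V).PairwiseDisjoint B := by
    intro x hx y hy hxy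
    refine Set.disjoint_left.2 fun v hv hv' ↦ ?_
    have h1 : N (v - l • x) ≤ 2 * ℓ := hv
    have h2 : N (v - l • y) ≤ 2 * ℓ := hv'
    have h3 : N (l • (x - y)) ≤ 4 * ℓ := by
      have : l • (x - y) = (v - l • y) - (v - l • x) := by rw [smul_sub]; abel
      rw [this]
      linarith [map_sub_le_add N (v - l • y) (v - l • x)]
    rw [map_smul_eq_mul, Real.norm_of_nonneg hlpos.le] at h3
    have h4 := mul_lt_mul_of_pos_left (hsep x hx y hy hxy) hlpos
    rw [show l * s = 4 * ℓ by rw [hl]; field_simp] at h4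
    linarith
  have hsum : ∑ x ∈ T, (stdGaussian V).real (B x) ≤ 1 := by
    rw [← measureReal_biUnion_finset hdisj fun x _ ↦ hBm x]
    exact measureReal_le_one
  have hlow : ∀ x ∈ T, rexp (-(8 * r ^ 2 * ℓ ^ 2 / s ^ 2)) * (1 / 2) ≤
      (stdGaussian V).real (B x) := by
    intro x hx
    refine le_trans ?_ (exp_mul_stdGaussian_le_translate hA hsymm (l • x))
    refine mul_le_mul (Real.exp_le_exp.2 ?_) hγA (by norm_num) (Real.exp_pos _).le
    rw [norm_smul, Real.norm_of_nonneg hlpos.le, neg_div, neg_le_neg_iff, mul_pow]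
    have : ‖x‖ ^ 2 ≤ r ^ 2 := pow_le_pow_left₀ (norm_nonneg _) (hT x hx) 2
    calc l ^ 2 * ‖x‖ ^ 2 / 2 ≤ l ^ 2 * r ^ 2 / 2 := by gcongr
      _ = 8 * r ^ 2 * ℓ ^ 2 / s ^ 2 := by rw [hl]; ring
  have h := (Finset.sum_le_sum hlow).trans hsum
  rw [Finset.sum_const, nsmul_eq_mul, Real.exp_neg] at h
  have hp := Real.exp_pos (8 * r ^ 2 * ℓ ^ 2 / s ^ 2)
  set e := rexp (8 * r ^ 2 * ℓ ^ 2 / s ^ 2)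
  have : (T.card : ℝ) * (e⁻¹ * (1 / 2)) * (2 * e) = T.card := by field_simp
  nlinarith

/-- Dual Sudakov inequality: a set of radius `r` has a small net for the seminorm `N`. -/
lemma exists_net (N : Seminorm ℝ V) {ℓ r s : ℝ} (hℓ : 0 < ℓ) (hs : 0 < s)
    (hN : ∫ v, N v ^ 2 ∂(stdGaussian V) ≤ ℓ ^ 2) (S : Set V) (hS : ∀ x ∈ S, ‖x‖ ≤ r) :
    ∃ T : Finset V, (∀ x ∈ T, x ∈ S) ∧ (T.card : ℝ) ≤ 2 * rexp (8 * r ^ 2 * ℓ ^ 2 / s ^ 2) ∧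
      ∀ x ∈ S, ∃ y ∈ T, N (x - y) ≤ s := by
  classical
  set P : Set ℕ := {k | ∃ T : Finset V, (∀ x ∈ T, x ∈ S) ∧
    (∀ x ∈ T, ∀ y ∈ T, x ≠ y → s < N (x - y)) ∧ T.card = k}
  have hne : P.Nonempty := ⟨0, ∅, by simp⟩
  have hbdd : BddAbove P := by
    refine ⟨⌈2 * rexp (8 * r ^ 2 * ℓ ^ 2 / s ^ 2)⌉₊, ?_⟩
    rintro k ⟨T, h1, h2, rfl⟩
    exact_mod_cast (card_le_of_separated N hℓ hs hN T (fun x hx ↦ hS x (h1 x hx)) h2).trans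
      (Nat.le_ceil _)
  obtain ⟨T, h1, h2, h3⟩ := Nat.sSup_mem hne hbdd
  refine ⟨T, h1, card_le_of_separated N hℓ hs hN T (fun x hx ↦ hS x (h1 x hx)) h2, fun x hx ↦ ?_⟩
  by_contra! hcon
  have hxT : x ∉ T := fun h ↦ by have := hcon x h; simp at this; linarith
  have : T.card + 1 ∈ P := by
    refine ⟨insert x T, ?_, ?_, Finset.card_insert_of_notMem hxT⟩
    · intro y hy
      rcases Finset.mem_insert.1 hy with rfl | hy
      exacts [hx, h1 y hy]
    · intro y hy z hz hyz
      rcases Finset.mem_insert.1 hy with rfl | hy' <;>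
        rcases Finset.mem_insert.1 hz with rfl | hz'
      · exact absurd rfl hyz
      · exact hcon z hz'
      · rw [map_sub_rev]; exact hcon y hy'
      · exact h2 y hy' z hz' hyz
  have := le_csSup hbdd this
  omega

/-- A net for the Euclidean norm. -/
lemma exists_norm_net {r s : ℝ} (hs : 0 < s) (S : Set V) (hS : ∀ x ∈ S, ‖x‖ ≤ r) :
    ∃ T : Finset V, (∀ x ∈ T, x ∈ S) ∧
      (T.card : ℝ) ≤ 2 * rexp (8 * r ^ 2 * Module.finrank ℝ V / s ^ 2) ∧
      ∀ x ∈ S, ∃ y ∈ T, ‖x - y‖ ≤ s := by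
  rcases Nat.eq_zero_or_pos (Module.finrank ℝ V) with h0 | h0
  · have : Subsingleton V := Module.finrank_zero_iff.1 h0
    rcases S.eq_empty_or_nonempty with rfl | ⟨x, hx⟩
    · exact ⟨∅, by simp, by simp; positivity, by simp⟩
    · exact ⟨{x}, by simpa using hx, by simp [h0], fun y hy ↦
        ⟨x, by simp, by simpa [Subsingleton.elim y x] using hs.le⟩⟩
  · have h := exists_net (normSeminorm ℝ V) (ℓ := √(Module.finrank ℝ V)) (r := r) (s := s)
      (by positivity) hs (by simp [integral_norm_sq_stdGaussian]) S hS
    simpa using h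

end Nets

section LowMStar

open ProbabilityTheory Real
open scoped RealInnerProductSpace ENNReal

variable {V : Type*} [NormedAddCommGroup V] [InnerProductSpace ℝ V] [FiniteDimensional ℝ V]

/-- The linear map with rows `ω i`. -/
noncomputable def rowMap {m : ℕ} (ω : Fin m → V) : V →L[ℝ] EuclideanSpace ℝ (Fin m) :=
  LinearMap.toContinuousLinearMap
    ((WithLp.linearEquiv 2 ℝ (Fin m → ℝ)).symm.toLinearMap ∘ₗ
      LinearMap.pi fun i ↦ (innerₛₗ ℝ (ω i)))

lemma rowMap_apply {m : ℕ} (ω : Fin m → V) (x : V) (i : Fin m) : rowMap ω x i = ⟪ω i, x⟫ := rfl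

lemma norm_rowMap_sq {m : ℕ} (ω : Fin m → V) (x : V) :
    ‖rowMap ω x‖ ^ 2 = ∑ i, ⟪x, ω i⟫ ^ 2 := by
  rw [EuclideanSpace.real_norm_sq_eq]
  simp_rw [rowMap_apply, real_inner_comm]

lemma norm_rowMap_le {m : ℕ} (ω : Fin m → V) {R : ℝ} (hR : 0 ≤ R) (T : Finset V)
    (hT : ∀ x : V, ‖x‖ = 1 → ∃ y ∈ T, ‖x - y‖ ≤ 1 / 2) (h : ∀ y ∈ T, ‖rowMap ω y‖ ≤ R) :
    ‖rowMap ω‖ ≤ 2 * R := by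
  have : ‖rowMap ω‖ ≤ R + ‖rowMap ω‖ / 2 := by
    refine ContinuousLinearMap.opNorm_le_of_unit_norm (by positivity) fun x hx ↦ ?_
    obtain ⟨y, hy, hxy⟩ := hT x hx
    have h1 : rowMap ω x = rowMap ω y + rowMap ω (x - y) := by rw [map_sub]; abel
    rw [h1]
    refine (norm_add_le _ _).trans (add_le_add (h y hy) ?_)
    refine ((rowMap ω).le_opNorm _).trans ?_
    nlinarith [norm_nonneg (rowMap ω)]
  linarith

lemma le_finrank_ker_rowMap {m : ℕ} (ω : Fin m → V) :
    Module.finrank ℝ V ≤ Module.finrank ℝ (rowMap ω).toLinearMap.ker + m := by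
  have h1 := (rowMap ω).toLinearMap.finrank_range_add_finrank_ker
  have h2 := Submodule.finrank_le (rowMap ω).toLinearMap.range
  simp only [finrank_euclideanSpace, Fintype.card_fin] at h2
  omega

lemma exp_sum_inner_sq {m : ℕ} (s : ℝ) (y : V) (ω : Fin m → V) :
    rexp (s * ‖rowMap ω y‖ ^ 2) = ∏ i, rexp (s * ⟪y, ω i⟫ ^ 2) := by
  rw [norm_rowMap_sq, Finset.mul_sum, Real.exp_sum]

variable [MeasurableSpace V] [BorelSpace V]

lemma integral_exp_norm_rowMap_sq (m : ℕ) {y : V} (hy : ‖y‖ = 1) {s : ℝ} (hs : s < 1 / 2) :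
    ∫ ω, rexp (s * ‖rowMap ω y‖ ^ 2) ∂(Measure.pi fun _ : Fin m ↦ stdGaussian V) =
      ((√(1 - 2 * s))⁻¹) ^ m := by
  simp_rw [exp_sum_inner_sq]
  rw [integral_fintype_prod_eq_pow (𝕜 := ℝ) (ι := Fin m) (fun v : V ↦ rexp (s * ⟪y, v⟫ ^ 2)),
    integral_exp_mul_inner_sq_stdGaussian hy hs, Fintype.card_fin]

lemma integrable_exp_norm_rowMap_sq (m : ℕ) {y : V} (hy : ‖y‖ = 1) {s : ℝ} (hs : s < 1 / 2) :
    Integrable (fun ω ↦ rexp (s * ‖rowMap ω y‖ ^ 2))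
      (Measure.pi fun _ : Fin m ↦ stdGaussian V) := by
  by_contra h
  have := integral_exp_norm_rowMap_sq m hy hs
  rw [integral_undef h] at this
  have h2 : 0 < ((√(1 - 2 * s))⁻¹) ^ m := by
    have : 0 < 1 - 2 * s := by linarith
    positivity
  exact h2.ne this

lemma measure_norm_rowMap_small (m : ℕ) {y : V} (hy : ‖y‖ = 1) :
    (Measure.pi fun _ : Fin m ↦ stdGaussian V).real {ω | ‖rowMap ω y‖ ^ 2 ≤ m / 8} ≤
      rexp (-(m / 2)) := by
  have h := mul_meas_ge_le_integral_of_nonneg (ae_of_all _ fun ω ↦ (Real.exp_pos _).le)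
    (integrable_exp_norm_rowMap_sq m hy (s := -4) (by norm_num)) (rexp (-4 * (m / 8)))
  rw [integral_exp_norm_rowMap_sq m hy (by norm_num)] at h
  have h1 : {ω : Fin m → V | ‖rowMap ω y‖ ^ 2 ≤ m / 8} =
      {ω | rexp (-4 * (m / 8)) ≤ rexp (-4 * ‖rowMap ω y‖ ^ 2)} := by
    ext ω
    simp only [Set.mem_ofPred_eq, Real.exp_le_exp]
    constructor <;> intro h <;> linarith
  rw [← h1] at h
  have h2 : √(1 - 2 * -4) = 3 := by rw [show (1 - 2 * -4 : ℝ) = 3 ^ 2 by norm_num]; simp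
  rw [h2] at h
  have h3 : ((3 : ℝ)⁻¹) ^ m ≤ rexp (-m) := by
    rw [show (-m : ℝ) = m * (-1) by ring, Real.exp_nat_mul, Real.exp_neg]
    have := Real.exp_one_lt_d9
    gcongr
    linarith
  have h4 := h.trans h3
  have h5 : rexp (-(m : ℝ)) = rexp (-4 * (m / 8)) * rexp (-(m / 2)) := by
    rw [← Real.exp_add]; congr 1; ring
  rw [h5] at h4
  exact le_of_mul_le_mul_left h4 (Real.exp_pos _)

lemma measure_norm_rowMap_large (m : ℕ) {y : V} (hy : ‖y‖ = 1) (a : ℝ) :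
    (Measure.pi fun _ : Fin m ↦ stdGaussian V).real {ω | a ≤ ‖rowMap ω y‖ ^ 2} ≤
      rexp (m / 2 - a / 4) := by
  have h := mul_meas_ge_le_integral_of_nonneg (ae_of_all _ fun ω ↦ (Real.exp_pos _).le)
    (integrable_exp_norm_rowMap_sq m hy (s := 1 / 4) (by norm_num)) (rexp (1 / 4 * a))
  rw [integral_exp_norm_rowMap_sq m hy (by norm_num)] at h
  have h1 : {ω : Fin m → V | a ≤ ‖rowMap ω y‖ ^ 2} =
      {ω | rexp (1 / 4 * a) ≤ rexp (1 / 4 * ‖rowMap ω y‖ ^ 2)} := by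
    ext ω
    simp only [Set.mem_ofPred_eq, Real.exp_le_exp]
    constructor <;> intro h <;> linarith
  rw [← h1] at h
  have h3 : ((√(1 - 2 * (1 / 4)))⁻¹) ^ m ≤ rexp (m / 2) := by
    rw [show (m / 2 : ℝ) = m * (1 / 2) by ring, Real.exp_nat_mul]
    refine pow_le_pow_left₀ (by positivity) ?_ m
    rw [← Real.sqrt_inv, Real.exp_half]
    refine Real.sqrt_le_sqrt ?_
    have := Real.exp_one_gt_d9
    norm_num
    linarith
  have h4 := h.trans h3
  have h5 : rexp (m / 2 : ℝ) = rexp (1 / 4 * a) * rexp (m / 2 - a / 4) := by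
    rw [← Real.exp_add]; congr 1; ring
  rw [h5] at h4
  exact le_of_mul_le_mul_left h4 (Real.exp_pos _)

/-- Given finitely many unit vectors, some row map has bounded norm and is bounded below
on these vectors. -/
lemma exists_rowMap {m : ℕ} (hn : 16 ≤ Module.finrank ℝ V) (hm1 : 2 * m ≤ Module.finrank ℝ V)
    (hm2 : Module.finrank ℝ V ≤ 3 * m) (T : Finset V) (hT1 : ∀ y ∈ T, ‖y‖ = 1)
    (hT : (T.card : ℝ) ≤ 2 * rexp (Module.finrank ℝ V / 32)) :
    ∃ ω : Fin m → V, ‖rowMap ω‖ ≤ 2 * √(160 * Module.finrank ℝ V) ∧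
      ∀ y ∈ T, (m / 8 : ℝ) < ‖rowMap ω y‖ ^ 2 := by
  set n : ℝ := (Module.finrank ℝ V : ℝ) with hndef
  have hn' : (16 : ℝ) ≤ n := by rw [hndef]; exact_mod_cast hn
  have hm1' : 2 * (m : ℝ) ≤ n := by rw [hndef]; exact_mod_cast hm1
  have hm2' : n ≤ 3 * (m : ℝ) := by rw [hndef]; exact_mod_cast hm2
  obtain ⟨Z, hZ1, hZc, hZ⟩ := exists_norm_net (V := V) (r := 1) (s := 1 / 2) (by norm_num)
    {x | ‖x‖ = 1} (fun x hx ↦ le_of_eq hx)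
  set μ := (Measure.pi fun _ : Fin m ↦ stdGaussian V)
  set B1 : Set (Fin m → V) := ⋃ z ∈ Z, {ω | 160 * n ≤ ‖rowMap ω z‖ ^ 2}
  set B2 : Set (Fin m → V) := ⋃ y ∈ T, {ω | ‖rowMap ω y‖ ^ 2 ≤ m / 8}
  have e4 : rexp (-2) < 1 / 4 := by
    rw [Real.exp_neg, show (2 : ℝ) = (2 : ℕ) * 1 by norm_num, Real.exp_nat_mul]
    have := Real.exp_one_gt_d9
    rw [inv_lt_comm₀ (by positivity) (by norm_num)]
    nlinarith
  have h1 : μ.real B1 ≤ 2 * rexp (-2) := by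
    calc μ.real B1 ≤ ∑ z ∈ Z, μ.real {ω | 160 * n ≤ ‖rowMap ω z‖ ^ 2} :=
          measureReal_biUnion_finset_le _ _
      _ ≤ ∑ z ∈ Z, rexp (m / 2 - 160 * n / 4) :=
          Finset.sum_le_sum fun z hz ↦ measure_norm_rowMap_large m (hZ1 z hz) _
      _ = Z.card * rexp (m / 2 - 160 * n / 4) := by rw [Finset.sum_const, nsmul_eq_mul]
      _ ≤ (2 * rexp (8 * 1 ^ 2 * n / (1 / 2) ^ 2)) * rexp (m / 2 - 160 * n / 4) := by gcongr
      _ = 2 * rexp (8 * 1 ^ 2 * n / (1 / 2) ^ 2 + (m / 2 - 160 * n / 4)) := by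
          rw [Real.exp_add]; ring
      _ ≤ _ := by
        gcongr
        norm_num
        linarith
  have h2 : μ.real B2 ≤ 2 * rexp (-2) := by
    calc μ.real B2 ≤ ∑ y ∈ T, μ.real {ω | ‖rowMap ω y‖ ^ 2 ≤ m / 8} :=
          measureReal_biUnion_finset_le _ _
      _ ≤ ∑ y ∈ T, rexp (-(m / 2)) :=
          Finset.sum_le_sum fun y hy ↦ measure_norm_rowMap_small m (hT1 y hy)
      _ = T.card * rexp (-(m / 2)) := by rw [Finset.sum_const, nsmul_eq_mul]
      _ ≤ (2 * rexp (n / 32)) * rexp (-(m / 2)) := by gcongr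
      _ = 2 * rexp (n / 32 + -(m / 2)) := by rw [Real.exp_add]; ring
      _ ≤ _ := by
        gcongr
        linarith
  have h3 : μ.real (B1 ∪ B2) < 1 := by
    have := measureReal_union_le (μ := μ) B1 B2
    linarith
  obtain ⟨ω, hω⟩ : ∃ ω, ω ∉ B1 ∪ B2 := by
    by_contra! hcon
    rw [Set.eq_univ_of_forall hcon, probReal_univ] at h3
    exact lt_irrefl _ h3
  simp only [Set.mem_union, not_or, B1, B2, Set.mem_iUnion, not_exists, Set.mem_ofPred_eq,
    not_le] at hω
  refine ⟨ω, norm_rowMap_le ω (by positivity) Z hZ fun z hz ↦ ?_, hω.2⟩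
  exact Real.le_sqrt_of_sq_le (hω.1 z hz).le

/-- The low `M*` estimate: on a subspace of half the dimension, the polar body of `N` has
controlled radius. -/
theorem exists_submodule_polar_le (N : Seminorm ℝ V) {ℓ : ℝ} (hℓ : 0 < ℓ)
    (hN : ∫ v, N v ^ 2 ∂(stdGaussian V) ≤ ℓ ^ 2) :
    ∃ F : Submodule ℝ V, Module.finrank ℝ V ≤ 2 * Module.finrank ℝ F ∧
      ∀ x ∈ F, (∀ y, ⟪x, y⟫ ≤ N y) → ‖x‖ * √(Module.finrank ℝ V) ≤ 2 ^ 19 * ℓ := by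
  set n := Module.finrank ℝ V with hndef
  rcases lt_or_ge n 16 with hn | hn
  · refine ⟨⊤, by simp [hndef]; omega, fun x _ hx ↦ ?_⟩
    have h1 : ‖x‖ ^ 2 ≤ ℓ ^ 2 := by
      rw [← integral_inner_sq_stdGaussian]
      refine le_trans (integral_mono ?_ N.integrable_sq_stdGaussian fun v ↦ ?_) hN
      · refine ((integrable_norm_sq_stdGaussian (V := V)).const_mul (‖x‖ ^ 2)).mono' (by fun_prop)
          (ae_of_all _ fun v ↦ ?_)
        rw [Real.norm_of_nonneg (sq_nonneg _), ← mul_pow]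
        exact sq_le_sq' (by linarith [abs_le.1 (abs_real_inner_le_norm x v)])
          (abs_le.1 (abs_real_inner_le_norm x v)).2
      · refine sq_le_sq' ?_ (hx v)
        have := hx (-v)
        rw [inner_neg_right, map_neg_eq_map] at this
        linarith
    have h2 : ‖x‖ ≤ ℓ := le_of_sq_le_sq h1 hℓ.le
    have h3 : √(n : ℝ) ≤ 4 := by
      rw [Real.sqrt_le_left (by norm_num)]
      have : (n : ℝ) ≤ 16 := by exact_mod_cast hn.le
      linarith
    calc ‖x‖ * √(n : ℝ) ≤ ℓ * 4 := by gcongr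
      _ ≤ 2 ^ 19 * ℓ := by linarith
  · have hn0 : (16 : ℝ) ≤ n := by exact_mod_cast hn
    have hsn : 0 < √(n : ℝ) := Real.sqrt_pos.2 (by linarith)
    obtain ⟨r, hr⟩ : ∃ r, r = 2 ^ 19 * ℓ / √(n : ℝ) := ⟨_, rfl⟩
    have hr0 : 0 < r := by rw [hr]; positivity
    have hr2 : r ^ 2 * n = 2 ^ 38 * ℓ ^ 2 := by
      rw [hr, div_pow, Real.sq_sqrt (by linarith)]
      field_simp
    set m := n / 2 with hm
    set S : Set V := {x | ‖x‖ = r ∧ ∀ y, ⟪x, y⟫ ≤ N y}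
    set s := r ^ 2 / 2 ^ 15 with hs
    obtain ⟨T, hT1, hTc, hT⟩ := exists_net N hℓ (show 0 < s by positivity) hN S (fun x hx ↦ hx.1.le)
    have hexp : 8 * r ^ 2 * ℓ ^ 2 / s ^ 2 = n / 32 := by
      rw [hs, div_eq_div_iff (by positivity) (by norm_num)]
      field_simp
      linear_combination -hr2
    rw [hexp] at hTc
    classical
    obtain ⟨ω, hω1, hω2⟩ := exists_rowMap (V := V) (m := m) hn (by omega) (by omega)
      (T.image fun y ↦ r⁻¹ • y) (by
        intro y hy
        obtain ⟨z, hz, rfl⟩ := Finset.mem_image.1 hy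
        rw [norm_smul, norm_inv, Real.norm_of_nonneg hr0.le, (hT1 z hz).1, inv_mul_cancel₀ hr0.ne'])
      (le_trans (by exact_mod_cast Finset.card_image_le) hTc)
    refine ⟨(rowMap ω).toLinearMap.ker, by have := le_finrank_ker_rowMap ω; omega, fun x hx hxN ↦ ?_⟩
    by_contra! hcon
    have hxr : r < ‖x‖ := by rw [hr, div_lt_iff₀ hsn]; exact hcon
    have hx0 : 0 < ‖x‖ := hr0.trans hxr
    set t := r / ‖x‖ with ht
    have ht0 : 0 < t := by positivity
    have ht1 : t ≤ 1 := by rw [ht, div_le_one hx0]; exact hxr.le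
    have hxS : t • x ∈ S := by
      refine ⟨by rw [norm_smul, Real.norm_of_nonneg ht0.le, ht]; field_simp, fun y ↦ ?_⟩
      rw [real_inner_smul_left]
      have := apply_nonneg N y
      nlinarith [hxN y]
    have hGx : rowMap ω (t • x) = 0 := by
      rw [map_smul, show rowMap ω x = 0 from hx, smul_zero]
    obtain ⟨y, hy, hxy⟩ := hT _ hxS
    have hd : ‖t • x - y‖ ^ 2 ≤ 2 * s := by
      rw [← real_inner_self_eq_norm_sq, inner_sub_left]
      have a1 := hxS.2 (t • x - y)
      have a2 := (hT1 y hy).2 (-(t • x - y))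
      rw [inner_neg_right, map_neg_eq_map] at a2
      linarith
    have hG : ‖rowMap ω y‖ ^ 2 ≤ 640 * n * (2 * s) := by
      have b1 : rowMap ω y = - rowMap ω (t • x - y) := by rw [map_sub, hGx]; simp
      have b2 : ‖rowMap ω y‖ ≤ 2 * √(160 * n) * ‖t • x - y‖ := by
        rw [b1, norm_neg]
        exact ((rowMap ω).le_opNorm _).trans (by gcongr)
      calc ‖rowMap ω y‖ ^ 2 ≤ (2 * √(160 * n) * ‖t • x - y‖) ^ 2 := by gcongr
        _ = 640 * n * ‖t • x - y‖ ^ 2 := by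
          rw [mul_pow, mul_pow, Real.sq_sqrt (by positivity)]; ring
        _ ≤ _ := by gcongr
    have hlow := hω2 (r⁻¹ • y) (Finset.mem_image_of_mem _ hy)
    rw [map_smul, norm_smul, mul_pow, norm_inv, Real.norm_of_nonneg hr0.le, inv_pow,
      inv_mul_eq_div, lt_div_iff₀ (by positivity)] at hlow
    have hm3 : (n : ℝ) ≤ 3 * m := by exact_mod_cast (by omega : n ≤ 3 * m)
    have h1 : (n : ℝ) / 24 * r ^ 2 ≤ m / 8 * r ^ 2 := 
      mul_le_mul_of_nonneg_right (by linarith) (sq_nonneg _)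
    have h2 := h1.trans_lt (hlow.trans_le hG)
    rw [hs] at h2
    have : 0 < (n : ℝ) * r ^ 2 := by positivity
    nlinarith

end LowMStar

section Subquotients

open scoped RealInnerProductSpace

/-- `M` is (isometric to) a subquotient of `N`: the quotient seminorm of the restriction of `N` to
`F` under a linear map. -/
def IsSubquotient {V V' : Type*} [AddCommGroup V] [Module ℝ V] [AddCommGroup V'] [Module ℝ V']
    (N : Seminorm ℝ V) (M : Seminorm ℝ V') : Prop :=
  ∃ (F : Submodule ℝ V) (π : V →ₗ[ℝ] V'), (∀ x ∈ F, M (π x) ≤ N x) ∧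
    ∀ y, ∃ x ∈ F, π x = y ∧ N x ≤ M y

namespace IsSubquotient

lemma trans {V V' V'' : Type*} [AddCommGroup V] [Module ℝ V] [AddCommGroup V'] [Module ℝ V']
    [AddCommGroup V''] [Module ℝ V''] {N : Seminorm ℝ V} {M : Seminorm ℝ V'} {P : Seminorm ℝ V''}
    (h : IsSubquotient N M) (h' : IsSubquotient M P) : IsSubquotient N P := by
  obtain ⟨F, π, h1, h2⟩ := h
  obtain ⟨F', π', h1', h2'⟩ := h'
  refine ⟨F ⊓ F'.comap π, π' ∘ₗ π, fun x hx ↦ (h1' _ hx.2).trans (h1 _ hx.1), fun z ↦ ?_⟩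
  obtain ⟨y, hy, rfl, hyz⟩ := h2' z
  obtain ⟨x, hx, rfl, hxy⟩ := h2 y
  exact ⟨x, ⟨hx, hy⟩, rfl, hxy.trans hyz⟩

lemma comp_equiv {V V' : Type*} [AddCommGroup V] [Module ℝ V] [AddCommGroup V'] [Module ℝ V']
    (N : Seminorm ℝ V) (e : V' ≃ₗ[ℝ] V) : IsSubquotient N (N.comp e.toLinearMap) :=
  ⟨⊤, e.symm.toLinearMap, fun x _ ↦ by simp, fun y ↦ ⟨e y, trivial, by simp, by simp⟩⟩

lemma comp_subtype {V : Type*} [AddCommGroup V] [Module ℝ V]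
    (N : Seminorm ℝ V) (F : Submodule ℝ V) : IsSubquotient N (N.comp F.subtype) := by
  obtain ⟨π, hπ⟩ := LinearMap.exists_leftInverse_of_injective F.subtype F.ker_subtype
  have hπ' : ∀ x : F, π x = x := fun x ↦ LinearMap.congr_fun hπ x
  exact ⟨F, π, fun x hx ↦ by simp [hπ' ⟨x, hx⟩], fun y ↦ ⟨y, y.2, hπ' y, le_rfl⟩⟩

end IsSubquotient

variable {V : Type*} [NormedAddCommGroup V] [InnerProductSpace ℝ V]

/-- The seminorms `N` and `M` are dual to each other with respect to the inner product. -/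
structure IsDualPair (N M : Seminorm ℝ V) : Prop where
  inner_le : ∀ x y, ⟪x, y⟫ ≤ N x * M y
  exists_left : ∀ y, ∃ x, N x ≤ 1 ∧ ⟪x, y⟫ = M y
  exists_right : ∀ x, ∃ y, M y ≤ 1 ∧ ⟪x, y⟫ = N x

namespace IsDualPair

lemma symm {N M : Seminorm ℝ V} (h : IsDualPair N M) : IsDualPair M N where
  inner_le x y := by rw [real_inner_comm, mul_comm]; exact h.inner_le y x
  exists_left y := by simpa only [real_inner_comm] using h.exists_right y
  exists_right y := by simpa only [real_inner_comm] using h.exists_left y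

lemma right_le {N M : Seminorm ℝ V} (h : IsDualPair N M) {c : ℝ} (hc : 0 < c)
    (hN : ∀ x, c * ‖x‖ ≤ N x) (y : V) : c * M y ≤ ‖y‖ := by
  obtain ⟨x, hx, hxy⟩ := h.exists_left y
  rw [← hxy]
  have h1 := real_inner_le_norm x y
  have h2 := (hN x).trans hx
  nlinarith [norm_nonneg y, norm_nonneg x, mul_le_mul_of_nonneg_right h2 (norm_nonneg y)]

lemma le_right {N M : Seminorm ℝ V} (h : IsDualPair N M) {C : ℝ}
    (hN : ∀ x, N x ≤ C * ‖x‖) (y : V) : ‖y‖ ≤ C * M y := by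
  rcases eq_or_ne y 0 with rfl | hy
  · simp
  have hy' : 0 < ‖y‖ := norm_pos_iff.2 hy
  have h1 := h.inner_le y y
  rw [real_inner_self_eq_norm_sq] at h1
  have h2 := mul_le_mul_of_nonneg_right (hN y) (apply_nonneg M y)
  have : ‖y‖ * ‖y‖ ≤ ‖y‖ * (C * M y) := by nlinarith
  exact le_of_mul_le_mul_left this hy'

variable [FiniteDimensional ℝ V]

lemma exists_of_le {N : Seminorm ℝ V} {c : ℝ} (hc : 0 < c) (hN : ∀ x, c * ‖x‖ ≤ N x) :
    ∃ M : Seminorm ℝ V, IsDualPair N M := by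
  have hcomp : IsCompact {x | N x ≤ 1} := by
    refine Metric.isCompact_of_isClosed_isBounded
      (isClosed_le N.continuous_of_finiteDimensional' continuous_const) ?_
    refine (Metric.isBounded_closedBall (x := (0 : V)) (r := c⁻¹)).subset fun x hx ↦ ?_
    rw [mem_closedBall_zero_iff, inv_eq_one_div, le_div_iff₀ hc, mul_comm]
    exact (hN x).trans hx
  have hmax : ∀ y, ∃ x, N x ≤ 1 ∧ ∀ z, N z ≤ 1 → ⟪z, y⟫ ≤ ⟪x, y⟫ := by
    intro y
    obtain ⟨x, hx, h⟩ := hcomp.exists_isMaxOn ⟨0, by simp⟩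
      (f := fun z ↦ ⟪z, y⟫) (by fun_prop)
    exact ⟨x, hx, fun z hz ↦ h hz⟩
  choose φ hφ1 hφ2 using hmax
  let M : Seminorm ℝ V := Seminorm.ofSMulLE (fun y ↦ ⟪φ y, y⟫) (by simp)
    (fun y z ↦ by
      rw [inner_add_right]
      exact add_le_add (hφ2 y _ (hφ1 _)) (hφ2 z _ (hφ1 _)))
    (fun a y ↦ by
      rw [inner_smul_right, Real.norm_eq_abs]
      rcases abs_cases a with ⟨h, ha⟩ | ⟨h, ha⟩
      · rw [h]
        exact mul_le_mul_of_nonneg_left (hφ2 y _ (hφ1 _)) ha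
      · rw [h]
        have := hφ2 y (-φ (a • y)) (by rw [map_neg_eq_map]; exact hφ1 _)
        rw [inner_neg_left] at this
        nlinarith)
  have hM : ∀ y, M y = ⟪φ y, y⟫ := fun y ↦ rfl
  refine ⟨M, fun x y ↦ ?_, fun y ↦ ⟨φ y, hφ1 y, rfl⟩, fun x ↦ ?_⟩
  · rcases eq_or_ne x 0 with rfl | hx
    · simp
    have hNx : 0 < N x := (mul_pos hc (norm_pos_iff.2 hx)).trans_le (hN x)
    have := hφ2 y ((N x)⁻¹ • x) (by
      rw [map_smul_eq_mul, norm_inv, Real.norm_of_nonneg hNx.le, inv_mul_cancel₀ hNx.ne'])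
    rw [real_inner_smul_left, inv_mul_le_iff₀ hNx] at this
    exact this
  · rcases eq_or_ne x 0 with rfl | hx
    · exact ⟨0, by simp, by simp⟩
    obtain ⟨g, hg1, hg2⟩ := exists_extension_of_le_sublinear
      (LinearPMap.mkSpanSingleton x (N x) hx) N
      (fun a ha y ↦ by rw [map_smul_eq_mul, Real.norm_of_nonneg ha.le])
      (fun y z ↦ map_add_le_add N y z) (by
        rintro ⟨y, hy⟩
        obtain ⟨a, rfl⟩ := Submodule.mem_span_singleton.1 hy
        have := LinearPMap.mkSpanSingleton'_apply x (N x) (fun c hc ↦ by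
          simp [(smul_eq_zero.1 hc).resolve_right hx]) a hy
        refine this.le.trans ?_
        rw [map_smul_eq_mul]
        exact mul_le_mul_of_nonneg_right (le_abs_self a) (apply_nonneg N x))
    have hgx : g x = N x := by
      have h1 := hg1 ⟨x, Submodule.mem_span_singleton_self x⟩
      simp only at h1
      rw [h1, LinearPMap.mkSpanSingleton_apply]
    have hr : ∀ z, ⟪z, (InnerProductSpace.toDual ℝ V).symm (LinearMap.toContinuousLinearMap g)⟫
        = g z := by
      intro z
      rw [real_inner_comm, InnerProductSpace.toDual_symm_apply]
      rfl
    refine ⟨(InnerProductSpace.toDual ℝ V).symm (LinearMap.toContinuousLinearMap g), ?_, ?_⟩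
    · rw [hM, hr]
      exact (hg2 _).trans (hφ1 _)
    · rw [hr, hgx]

/-- The dual of the restriction of the dual seminorm to a subspace is a quotient. -/
lemma isSubquotient {N M : Seminorm ℝ V} (h : IsDualPair N M) (F : Submodule ℝ V)
    {N₂ : Seminorm ℝ F} (h₂ : IsDualPair N₂ (M.comp F.subtype)) : IsSubquotient N N₂ := by
  refine ⟨⊤, F.orthogonalProjectionOnto.toLinearMap, fun x _ ↦ ?_, fun z ↦ ?_⟩
  · obtain ⟨y, hy, hxy⟩ := h₂.exists_right (F.orthogonalProjectionOnto x)
    change N₂ (F.orthogonalProjectionOnto x) ≤ N x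
    have h1 := h.inner_le x y
    have h2 : ⟪F.orthogonalProjectionOnto x, y⟫ = ⟪x, (y : V)⟫ := by
      simp
    have h3 : M (y : V) ≤ 1 := hy
    rw [← hxy, h2]
    nlinarith [apply_nonneg N x]
  · obtain ⟨g, hg1, hg2⟩ := exists_extension_of_le_sublinear
      (⟨F, (innerₛₗ ℝ z)⟩ : V →ₗ.[ℝ] ℝ) (fun y ↦ N₂ z * M y)
      (fun a ha y ↦ by rw [map_smul_eq_mul, Real.norm_of_nonneg ha.le]; ring)
      (fun y w ↦ by rw [← mul_add]; exact mul_le_mul_of_nonneg_left (map_add_le_add M y w)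
                                          (apply_nonneg N₂ z))
      (fun y ↦ h₂.inner_le z y)
    have hr : ∀ w, ⟪(InnerProductSpace.toDual ℝ V).symm (LinearMap.toContinuousLinearMap g), w⟫
        = g w := by
      intro w
      rw [InnerProductSpace.toDual_symm_apply]
      rfl
    refine ⟨(InnerProductSpace.toDual ℝ V).symm (LinearMap.toContinuousLinearMap g), trivial, ?_, ?_⟩
    · refine ext_inner_right ℝ fun y ↦ ?_
      have h1 := hg1 y
      have h2 : g y = ⟪z, y⟫ := h1
      rw [← h2, ← hr]
      simp
    · obtain ⟨y, hy, hxy⟩ := h.exists_right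
        ((InnerProductSpace.toDual ℝ V).symm (LinearMap.toContinuousLinearMap g))
      rw [← hxy, hr]
      refine (hg2 y).trans ?_
      nlinarith [apply_nonneg N₂ z]

end IsDualPair

end Subquotients

section SignCube

open scoped BigOperators RealInnerProductSpace

/-- A sign as a real number. -/
def signReal (u : ℤˣ) : ℝ := ((u : ℤ) : ℝ)

@[simp] lemma signReal_one : signReal 1 = 1 := by simp [signReal]

@[simp] lemma signReal_neg_one : signReal (-1) = -1 := by simp [signReal]

@[simp] lemma signReal_mul (u v : ℤˣ) : signReal (u * v) = signReal u * signReal v := by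
  simp [signReal]

@[simp] lemma signReal_mul_self (u : ℤˣ) : signReal u * signReal u = 1 := by
  rcases Int.units_eq_one_or u with rfl | rfl <;> simp

lemma abs_signReal (u : ℤˣ) : |signReal u| = 1 := by
  rcases Int.units_eq_one_or u with rfl | rfl <;> simp

variable {ι : Type*} [Fintype ι] [DecidableEq ι]

lemma card_signs : (Fintype.card (ι → ℤˣ) : ℝ) = 2 ^ Fintype.card ι := by
  simp

lemma expect_signs_prod (g : ι → ℤˣ → ℝ) :
    𝔼 η : ι → ℤˣ, ∏ i, g i (η i) = ∏ i, ((g i 1 + g i (-1)) / 2) := by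
  have h := Finset.prod_univ_sum (fun _ : ι ↦ (Finset.univ : Finset ℤˣ)) g
  rw [Fintype.piFinset_univ] at h
  rw [Finset.expect_eq_sum_div_card, ← h, Finset.card_univ, card_signs, Finset.prod_div_distrib]
  simp

lemma expect_prod_one_add (a : ι → ℝ) :
    𝔼 η : ι → ℤˣ, ∏ i, (1 + a i * signReal (η i)) = 1 := by
  rw [expect_signs_prod (fun i u ↦ 1 + a i * signReal u)]
  exact Finset.prod_eq_one fun i _ ↦ by rw [signReal_one, signReal_neg_one]; ring

lemma expect_prod_one_add_mul (a : ι → ℝ) (j : ι) :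
    𝔼 η : ι → ℤˣ, (∏ i, (1 + a i * signReal (η i))) * signReal (η j) = a j := by
  have : ∀ η : ι → ℤˣ, (∏ i, (1 + a i * signReal (η i))) * signReal (η j) =
      ∏ i, ((1 + a i * signReal (η i)) * if i = j then signReal (η i) else 1) := by
    intro η
    rw [Finset.prod_mul_distrib, Finset.prod_ite_eq' Finset.univ j]
    simp
  simp_rw [this]
  rw [expect_signs_prod (fun i u ↦ (1 + a i * signReal u) * if i = j then signReal u else 1),
    Finset.prod_eq_single j]
  · simp; ring
  · intro i _ hij; simp [hij]; ring
  · simp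

variable {V : Type*} [AddCommGroup V] [Module ℝ V]

/-- The mean square of the seminorm of a Rademacher sum. -/
noncomputable def radSq (N : Seminorm ℝ V) (x : ι → V) : ℝ :=
  𝔼 ε : ι → ℤˣ, N (∑ i, signReal (ε i) • x i) ^ 2

lemma radSq_nonneg (N : Seminorm ℝ V) (x : ι → V) : 0 ≤ radSq N x :=
  Finset.expect_nonneg fun _ _ ↦ sq_nonneg _

lemma expect_signs_mul (ε : ι → ℤˣ) (f : (ι → ℤˣ) → ℝ) :
    𝔼 η : ι → ℤˣ, f (ε * η) = 𝔼 η : ι → ℤˣ, f η :=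
  Fintype.expect_equiv (Equiv.mulLeft ε) _ _ fun _ ↦ rfl

lemma Seminorm.sq_expect_le (N : Seminorm ℝ V) {Ω : Type*} [Fintype Ω] (w : Ω → ℝ)
    (hw : ∀ η, 0 ≤ w η) (hw1 : 𝔼 η, w η = 1) (z : Ω → V) :
    N (∑ η, (w η / Fintype.card Ω) • z η) ^ 2 ≤ 𝔼 η, w η * N (z η) ^ 2 := by
  have hconv : ConvexOn ℝ Set.univ (fun v ↦ N v ^ 2) :=
    N.convexOn.pow (fun v _ ↦ apply_nonneg N v) 2
  have h := hconv.map_sum_le (t := Finset.univ) (w := fun η ↦ w η / Fintype.card Ω)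
    (p := z) (fun η _ ↦ div_nonneg (hw η) (Nat.cast_nonneg _))
    (by rw [← Finset.sum_div, ← hw1, Finset.expect_eq_sum_div_card, Finset.card_univ])
    (fun _ _ ↦ trivial)
  refine h.trans (le_of_eq ?_)
  rw [Finset.expect_eq_sum_div_card, Finset.sum_div]
  refine Finset.sum_congr rfl fun η _ ↦ ?_
  rw [smul_eq_mul, Finset.card_univ]
  ring

/-- The contraction principle. -/
lemma radSq_contraction (N : Seminorm ℝ V) (x : ι → V) {a : ι → ℝ} (ha : ∀ i, |a i| ≤ 1) :
    radSq N (fun i ↦ a i • x i) ≤ radSq N x := by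
  set w : (ι → ℤˣ) → ℝ := fun η ↦ ∏ i, (1 + a i * signReal (η i)) with hwdef
  have hw : ∀ η, 0 ≤ w η := by
    intro η
    refine Finset.prod_nonneg fun i _ ↦ ?_
    have h1 := abs_le.1 (ha i)
    rcases Int.units_eq_one_or (η i) with h | h <;> rw [h] <;> simp <;> linarith
  have hw1 : 𝔼 η, w η = 1 := expect_prod_one_add a
  have key : ∀ ε : ι → ℤˣ, N (∑ i, signReal (ε i) • a i • x i) ^ 2 ≤
      𝔼 η, w η * N (∑ i, signReal ((ε * η) i) • x i) ^ 2 := by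
    intro ε
    refine le_trans (le_of_eq ?_) (N.sq_expect_le w hw hw1 _)
    congr 2
    simp_rw [Finset.smul_sum]
    rw [Finset.sum_comm]
    refine Finset.sum_congr rfl fun i _ ↦ ?_
    simp_rw [smul_smul]
    rw [← Finset.sum_smul]
    congr 1
    have h := expect_prod_one_add_mul a i
    rw [Finset.expect_eq_sum_div_card, Finset.card_univ] at h
    rw [← h, Finset.sum_div, Finset.mul_sum]
    refine Finset.sum_congr rfl fun η _ ↦ ?_
    simp [hwdef]
    ring
  calc radSq N (fun i ↦ a i • x i)
      ≤ 𝔼 ε : ι → ℤˣ, 𝔼 η, w η * N (∑ i, signReal ((ε * η) i) • x i) ^ 2 :=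
        Finset.expect_le_expect fun ε _ ↦ key ε
    _ = 𝔼 η, w η * 𝔼 ε : ι → ℤˣ, N (∑ i, signReal ((η * ε) i) • x i) ^ 2 := by
        rw [Finset.expect_comm]
        simp_rw [Finset.mul_expect, mul_comm]
    _ = 𝔼 η, w η * radSq N x := by
        refine Finset.expect_congr rfl fun η _ ↦ ?_
        rw [expect_signs_mul η (fun ε ↦ N (∑ i, signReal (ε i) • x i) ^ 2)]
        rfl
    _ = radSq N x := by rw [← Finset.expect_mul, hw1, one_mul]

lemma radSq_smul_le (N : Seminorm ℝ V) (x : ι → V) {a : ι → ℝ} {b : ℝ} (hb : 0 ≤ b)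
    (ha : ∀ i, |a i| ≤ b) : radSq N (fun i ↦ a i • x i) ≤ b ^ 2 * radSq N x := by
  rcases hb.eq_or_lt with rfl | hb
  · have : ∀ i, a i = 0 := fun i ↦ abs_nonpos_iff.1 (ha i)
    simp [this, radSq]
  · have h := radSq_contraction N (fun i ↦ b • x i) (a := fun i ↦ a i / b) (fun i ↦ by
      rw [abs_div, abs_of_pos hb, div_le_one hb]; exact ha i)
    have h1 : (fun i ↦ (a i / b) • b • x i) = fun i ↦ a i • x i := by
      ext i; rw [smul_smul, div_mul_cancel₀ _ hb.ne']
    rw [h1] at h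
    refine h.trans (le_of_eq ?_)
    unfold radSq
    rw [Finset.mul_expect]
    refine Finset.expect_congr rfl fun ε _ ↦ ?_
    rw [show ∑ i, signReal (ε i) • b • x i = b • ∑ i, signReal (ε i) • x i by
      rw [Finset.smul_sum]; exact Finset.sum_congr rfl fun i _ ↦ smul_comm _ _ _,
      map_smul_eq_mul, Real.norm_of_nonneg hb.le, mul_pow]

lemma sq_le_radSq (N : Seminorm ℝ V) (x : ι → V) (j : ι) : N (x j) ^ 2 ≤ radSq N x := by
  refine le_trans (le_of_eq ?_)
    (radSq_contraction N x (a := fun i ↦ if i = j then 1 else 0) (fun i ↦ by split_ifs <;> simp))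
  unfold radSq
  have : ∀ ε : ι → ℤˣ, N (∑ i, signReal (ε i) • (if i = j then (1 : ℝ) else 0) • x i) ^ 2 =
      N (x j) ^ 2 := by
    intro ε
    rw [Finset.sum_eq_single j]
    · rw [if_pos rfl, one_smul, map_smul_eq_mul, Real.norm_eq_abs, abs_signReal, one_mul]
    · intro i _ hij; simp [hij]
    · simp
  simp_rw [this]
  rw [Finset.expect_const Finset.univ_nonempty]

end SignCube

section CoefficientBound

open Finset

/-- Markov-type inequality -/
lemma abs_coeff_one_le {D m : ℕ} (hm : 1 ≤ m) {d : ℝ} (hd : d ≤ 4 ^ m) (a : ℕ → ℝ)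
    (ha : ∀ k, |a k| ≤ d)
    (h : ∀ t : ℝ, |t| ≤ 1 → |∑ k ∈ range (D + 1), a k * t ^ k| ≤ 1) (hD : 1 ≤ D) :
    |a 1| ≤ 14 * m ^ 2 := by
  have hm0 : (0 : ℝ) < m := by exact_mod_cast hm
  have hm1 : (1 : ℝ) ≤ m := by exact_mod_cast hm
  set ψ : ℝ → ℝ := fun t ↦ ∑ k ∈ range D, a (k + 1) * t ^ k with hψ
  have hφ : ∀ t : ℝ, ∑ k ∈ range (D + 1), a k * t ^ k = a 0 + t * ψ t := by
    intro t
    rw [sum_range_succ', hψ, mul_sum, add_comm]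
    simp only [pow_zero, mul_one]
    congr 1
    exact sum_congr rfl fun k _ ↦ by ring
  have ha0 : |a 0| ≤ 1 := by simpa [hφ] using h 0 (by simp)
  have hψ1 : ∀ t : ℝ, |t| ≤ 1 → |t| * |ψ t| ≤ 2 := by
    intro t ht
    have h1 := h t ht
    rw [hφ] at h1
    rw [← abs_mul]
    calc |t * ψ t| = |(a 0 + t * ψ t) - a 0| := by congr 1; ring
      _ ≤ |a 0 + t * ψ t| + |a 0| := abs_sub _ _
      _ ≤ 2 := by linarith
  set P : Polynomial ℝ := ∑ k ∈ range (min D (2 * m)), Polynomial.C (a (k + 1)) *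
    (Polynomial.C (1 / (2 * m : ℝ)) * (Polynomial.X - Polynomial.C (m : ℝ))) ^ k with hP
  have hPdeg : P.natDegree < 2 * m := by
    refine lt_of_le_of_lt (b := 2 * m - 1) (Polynomial.natDegree_sum_le_of_forall_le _ _ ?_) (by omega)
    intro k hk
    have hk' : k < 2 * m := (mem_range.1 hk).trans_le (min_le_right _ _)
    refine (Polynomial.natDegree_C_mul_le _ _).trans ?_
    refine (Polynomial.natDegree_pow_le).trans ?_
    have : (Polynomial.C (1 / (2 * m : ℝ)) * (Polynomial.X - Polynomial.C (m : ℝ))).natDegree ≤ 1 :=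
      (Polynomial.natDegree_C_mul_le _ _).trans (Polynomial.natDegree_X_sub_C_le _)
    calc k * _ ≤ k * 1 := by gcongr
      _ ≤ 2 * m - 1 := by omega
  set t : ℕ → ℝ := fun i ↦ 1 / (2 * m : ℝ) * ((i : ℝ) - m) with ht
  have htle : ∀ i ∈ range (2 * m + 1), |t i| ≤ 1 / 2 := by
    intro i hi
    have hi' : (i : ℝ) ≤ 2 * m := by
      have := mem_range.1 hi
      exact_mod_cast (by omega : i ≤ 2 * m)
    have h0 : (0 : ℝ) ≤ i := Nat.cast_nonneg _
    rw [ht]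
    simp only
    rw [abs_mul, abs_of_pos (by positivity), div_mul_eq_mul_div, one_mul, div_le_iff₀ (by positivity),
      abs_le]
    constructor <;> linarith
  have hfin : ∑ k ∈ range (2 * m + 1), ((-1 : ℝ) ^ (2 * m - k) * ((2 * m).choose k : ℝ)) *
      P.eval (k : ℝ) = 0 := by
    have h1 := fwdDiff_iter_eq_sum_shift (1 : ℝ) (fun x ↦ P.eval x) (2 * m) 0
    rw [Polynomial.fwdDiff_iter_eq_zero_of_degree_lt hPdeg] at h1
    simp only [Pi.zero_apply, zero_add, nsmul_eq_mul, mul_one] at h1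
    rw [h1]
    refine sum_congr rfl fun k _ ↦ ?_
    rw [zsmul_eq_mul]
    push_cast
    ring
  have htail : ∀ x : ℝ, |x| ≤ 1 / 2 →
      |ψ x - ∑ k ∈ range (min D (2 * m)), a (k + 1) * x ^ k| ≤ 2 := by
    intro x hx
    rcases le_total D (2 * m) with hDm | hDm
    · rw [min_eq_left hDm, sub_self, abs_zero]
      norm_num
    · obtain ⟨e, rfl⟩ := Nat.exists_eq_add_of_le hDm
      rw [min_eq_right hDm, hψ]
      simp only
      rw [sum_range_add, add_sub_cancel_left]
      refine (abs_sum_le_sum_abs _ _).trans (le_trans (sum_le_sum fun k _ ↦ ?_)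
        (sum_geometric_two_le e))
      rw [abs_mul, abs_pow, pow_add, ← mul_assoc]
      have h1 : |a (2 * m + k + 1)| * |x| ^ (2 * m) ≤ 4 ^ m * (1 / 2) ^ (2 * m) :=
        mul_le_mul ((ha _).trans hd) (pow_le_pow_left₀ (abs_nonneg _) hx _) (by positivity)
          (by positivity)
      have h2 : (4 : ℝ) ^ m * (1 / 2) ^ (2 * m) = 1 := by
        rw [pow_mul, ← mul_pow]; norm_num
      rw [h2] at h1
      calc |a (2 * m + k + 1)| * |x| ^ (2 * m) * |x| ^ k ≤ 1 * (1 / 2) ^ k :=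
            mul_le_mul h1 (pow_le_pow_left₀ (abs_nonneg _) hx _) (by positivity) zero_le_one
        _ = _ := one_mul _
  have hPe : ∀ i : ℕ, P.eval (i : ℝ) = ∑ k ∈ range (min D (2 * m)), a (k + 1) * (t i) ^ k := by
    intro i
    simp [hP, Polynomial.eval_finsetSum, ht]
  have hψ0 : ψ 0 = a 1 := by
    obtain ⟨D', rfl⟩ : ∃ D', D = D' + 1 := ⟨D - 1, by omega⟩
    rw [hψ]
    simp only
    rw [sum_range_succ']
    simp
  have hC : (0 : ℝ) < ((2 * m).choose m : ℝ) := by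
    exact_mod_cast Nat.choose_pos (by omega)
  have hCle : ∀ i, ((2 * m).choose i : ℝ) ≤ ((2 * m).choose m : ℝ) := by
    intro i
    exact_mod_cast Nat.choose_le_centralBinom i m
  have hmem : m ∈ range (2 * m + 1) := mem_range.2 (by omega)
  have htm : t m = 0 := by simp [ht]
  have hψeq : ((2 * m).choose m : ℝ) * |a 1| ≤ ((2 * m).choose m : ℝ) * (8 * m ^ 2 + (2 * m + 1) * 2) := by
    have e1 : ∑ k ∈ range (2 * m + 1), ((-1 : ℝ) ^ (2 * m - k) * ((2 * m).choose k : ℝ)) *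
        (ψ (t k) - P.eval (k : ℝ)) = ∑ k ∈ (range (2 * m + 1)).erase m,
          ((-1 : ℝ) ^ (2 * m - k) * ((2 * m).choose k : ℝ)) * ψ (t k) +
          ((-1 : ℝ) ^ (2 * m - m) * ((2 * m).choose m : ℝ)) * a 1 := by
      simp_rw [mul_sub]
      rw [sum_sub_distrib, hfin, sub_zero, ← sum_erase_add _ _ hmem, htm, hψ0]
    have e2 : ((-1 : ℝ) ^ (2 * m - m) * ((2 * m).choose m : ℝ)) * a 1 =
      ∑ k ∈ range (2 * m + 1), ((-1 : ℝ) ^ (2 * m - k) * ((2 * m).choose k : ℝ)) *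
        (ψ (t k) - P.eval (k : ℝ)) - ∑ k ∈ (range (2 * m + 1)).erase m,
          ((-1 : ℝ) ^ (2 * m - k) * ((2 * m).choose k : ℝ)) * ψ (t k) := by linarith
    have e3 : |((-1 : ℝ) ^ (2 * m - m) * ((2 * m).choose m : ℝ)) * a 1| =
        ((2 * m).choose m : ℝ) * |a 1| := by
      rw [abs_mul, abs_mul, abs_pow, abs_neg, abs_one, one_pow, one_mul, abs_of_pos hC]
    have habs : ∀ k, |(-1 : ℝ) ^ (2 * m - k) * ((2 * m).choose k : ℝ)| ≤ ((2 * m).choose m : ℝ) := by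
      intro k
      rw [abs_mul, abs_pow, abs_neg, abs_one, one_pow, one_mul, abs_of_nonneg (by positivity)]
      exact hCle k
    rw [← e3, e2]
    refine (abs_sub _ _).trans ?_
    have f1 : |∑ k ∈ range (2 * m + 1), ((-1 : ℝ) ^ (2 * m - k) * ((2 * m).choose k : ℝ)) *
        (ψ (t k) - P.eval (k : ℝ))| ≤ (2 * m + 1) * (((2 * m).choose m : ℝ) * 2) := by
      refine (abs_sum_le_sum_abs _ _).trans ((sum_le_card_nsmul _ _ (((2 * m).choose m : ℝ) * 2) ?_).trans
        (le_of_eq ?_))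
      · intro k hk
        rw [abs_mul]
        refine mul_le_mul (habs k) ?_ (abs_nonneg _) hC.le
        rw [hPe]
        exact htail _ (htle k hk)
      · rw [card_range, nsmul_eq_mul]; push_cast; ring
    have f2 : |∑ k ∈ (range (2 * m + 1)).erase m, ((-1 : ℝ) ^ (2 * m - k) * ((2 * m).choose k : ℝ)) *
        ψ (t k)| ≤ (2 * m) * (((2 * m).choose m : ℝ) * (4 * m)) := by
      refine (abs_sum_le_sum_abs _ _).trans ((sum_le_card_nsmul _ _ (((2 * m).choose m : ℝ) * (4 * m)) ?_).trans
        (le_of_eq ?_))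
      · intro k hk
        rw [abs_mul]
        refine mul_le_mul (habs k) ?_ (abs_nonneg _) hC.le
        have hk1 := (mem_erase.1 hk).1
        have h1 := hψ1 (t k) ((htle k (mem_erase.1 hk).2).trans (by norm_num))
        have h2 : 1 / (2 * m) ≤ |t k| := by
          rw [ht]
          simp only
          rw [abs_mul, abs_of_pos (by positivity : (0 : ℝ) < 1 / (2 * m))]
          have : (1 : ℝ) ≤ |(k : ℝ) - m| := by
            have h3 : (1 : ℤ) ≤ |(k : ℤ) - m| := Int.one_le_abs (by omega)
            exact_mod_cast h3
          exact le_mul_of_one_le_right (by positivity) this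
        have h3 : 1 / (2 * m) * |ψ (t k)| ≤ 2 := (mul_le_mul_of_nonneg_right h2 (abs_nonneg _)).trans h1
        rw [div_mul_eq_mul_div, one_mul, div_le_iff₀ (by positivity)] at h3
        linarith
      · rw [card_erase_of_mem hmem, card_range, nsmul_eq_mul]; simp
    calc _ ≤ (2 * m + 1) * (((2 * m).choose m : ℝ) * 2) + (2 * m) * (((2 * m).choose m : ℝ) * (4 * m)) :=
          add_le_add f1 f2
      _ = _ := by ring
  have := le_of_mul_le_mul_left hψeq hC
  nlinarith

end CoefficientBound

section KConvexity

open scoped BigOperators RealInnerProductSpace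

variable {ι : Type*} [Fintype ι] [DecidableEq ι]
variable {V : Type*} [NormedAddCommGroup V] [InnerProductSpace ℝ V]

/-- The average of a vector-valued function on a finite type. -/
noncomputable def vectorMean {Ω : Type*} [Fintype Ω] (f : Ω → V) : V :=
  (Fintype.card Ω : ℝ)⁻¹ • ∑ ε, f ε

lemma inner_vectorMean {Ω : Type*} [Fintype Ω] (f : Ω → V) (y : V) :
    ⟪vectorMean f, y⟫ = 𝔼 ε, ⟪f ε, y⟫ := by
  rw [vectorMean, real_inner_smul_left, sum_inner, Finset.expect_eq_sum_div_card, Finset.card_univ]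
  ring

/-- The Walsh functions on the sign cube. -/
def walsh (A : Finset ι) (ε : ι → ℤˣ) : ℝ := ∏ i ∈ A, signReal (ε i)

/-- The Walsh coefficients of a vector-valued function. -/
noncomputable def walshCoeff (A : Finset ι) (f : (ι → ℤˣ) → V) : V :=
  vectorMean fun ε ↦ walsh A ε • f ε

lemma inner_walshCoeff_left (A : Finset ι) (f : (ι → ℤˣ) → V) (y : V) :
    ⟪walshCoeff A f, y⟫ = 𝔼 ε, walsh A ε * ⟪f ε, y⟫ := by
  rw [walshCoeff, inner_vectorMean]
  simp_rw [real_inner_smul_left]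

lemma inner_walshCoeff (A : Finset ι) (f h : (ι → ℤˣ) → V) :
    ⟪walshCoeff A f, walshCoeff A h⟫ =
      𝔼 ε, 𝔼 η, walsh A ε * walsh A η * ⟪f ε, h η⟫ := by
  rw [inner_walshCoeff_left]
  refine Finset.expect_congr rfl fun ε _ ↦ ?_
  rw [real_inner_comm, inner_walshCoeff_left, Finset.mul_expect]
  refine Finset.expect_congr rfl fun η _ ↦ ?_
  rw [real_inner_comm]
  ring

lemma sum_pow_mul_walsh {ι : Type*} [Fintype ι] (ρ : ℝ) (ε η : ι → ℤˣ) :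
    ∑ A : Finset ι, ρ ^ A.card * (walsh A ε * walsh A η) =
      ∏ i, (1 + ρ * signReal (ε i) * signReal (η i)) := by
  rw [Finset.prod_one_add, Finset.powerset_univ]
  refine Finset.sum_congr rfl fun A _ ↦ ?_
  simp only [walsh, Finset.prod_mul_distrib, Finset.prod_const]
  ring

lemma sum_pow_mul_inner_walshCoeff (ρ : ℝ) (f h : (ι → ℤˣ) → V) :
    ∑ A : Finset ι, ρ ^ A.card * ⟪walshCoeff A f, walshCoeff A h⟫ =
      𝔼 ε, 𝔼 η, (∏ i, (1 + ρ * signReal (ε i) * signReal (η i))) * ⟪f ε, h η⟫ := by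
  simp_rw [← sum_pow_mul_walsh, inner_walshCoeff, Finset.sum_mul, Finset.expect_sum_comm,
    Finset.mul_expect]
  refine Finset.sum_congr rfl fun A _ ↦ Finset.expect_congr rfl fun ε _ ↦
    Finset.expect_congr rfl fun η _ ↦ ?_
  ring

lemma expect_prod_one_add_signs_mul (ε : ι → ℤˣ) (g : (ι → ℤˣ) → ℝ) :
    𝔼 η, (∏ i, (1 + 1 * signReal (ε i) * signReal (η i))) * g η = g ε := by
  have : ∀ η : ι → ℤˣ, (∏ i, (1 + 1 * signReal (ε i) * signReal (η i))) * g η =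
      if ε = η then 2 ^ Fintype.card ι * g η else 0 := by
    intro η
    split_ifs with h
    · subst h
      simp_rw [one_mul, signReal_mul_self]
      rw [Finset.prod_const, Finset.card_univ]
      norm_num
    · obtain ⟨i, hi⟩ := Function.ne_iff.1 h
      rw [Finset.prod_eq_zero (Finset.mem_univ i), zero_mul]
      rcases Int.units_eq_one_or (ε i) with h1 | h1 <;>
        rcases Int.units_eq_one_or (η i) with h2 | h2 <;> simp_all
  simp_rw [this]
  rw [Finset.expect_eq_sum_div_card, Finset.sum_ite_eq, if_pos (Finset.mem_univ _),
    Finset.card_univ, card_signs]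
  field_simp

lemma sum_norm_walshCoeff_sq (f : (ι → ℤˣ) → V) :
    ∑ A : Finset ι, ‖walshCoeff A f‖ ^ 2 = 𝔼 ε, ‖f ε‖ ^ 2 := by
  have h := sum_pow_mul_inner_walshCoeff 1 f f
  simp_rw [expect_prod_one_add_signs_mul, one_pow, one_mul, real_inner_self_eq_norm_sq] at h
  exact h

lemma expect_add_sq_le {Ω : Type*} [Fintype Ω] {N M : Seminorm ℝ V} (hNM : IsDualPair N M)
    (k : Ω → Ω → ℝ) (hk : ∀ ε η, 0 ≤ k ε η) (hk1 : ∀ ε, 𝔼 η, k ε η = 1)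
    (hk2 : ∀ η, 𝔼 ε, k ε η = 1) {f h : Ω → V} (hf : 𝔼 ε, N (f ε) ^ 2 ≤ 1)
    (hh : 𝔼 ε, M (h ε) ^ 2 ≤ 1) : |𝔼 ε, 𝔼 η, k ε η * ⟪f ε, h η⟫| ≤ 1 := by
  have h1 : |𝔼 ε, 𝔼 η, k ε η * ⟪f ε, h η⟫| ≤
      𝔼 ε, 𝔼 η, (k ε η * (N (f ε) ^ 2 / 2) + k ε η * (M (h η) ^ 2 / 2)) := by
    refine (Finset.abs_expect_le _ _).trans (Finset.expect_le_expect fun ε _ ↦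
      (Finset.abs_expect_le _ _).trans (Finset.expect_le_expect fun η _ ↦ ?_))
    rw [abs_mul, abs_of_nonneg (hk ε η), ← mul_add]
    refine mul_le_mul_of_nonneg_left ?_ (hk ε η)
    have a1 := hNM.inner_le (f ε) (h η)
    have a2 := hNM.inner_le (-f ε) (h η)
    rw [inner_neg_left, map_neg_eq_map] at a2
    rw [abs_le]
    constructor <;> nlinarith [sq_nonneg (N (f ε) - M (h η))]
  refine h1.trans ?_
  simp_rw [Finset.expect_add_distrib, ← Finset.expect_mul, hk1, one_mul]
  rw [Finset.expect_comm]
  simp_rw [← Finset.expect_mul, hk2, one_mul, ← Finset.expect_div]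
  linarith

lemma sum_inner_walshCoeff_le_of_le_one {N M : Seminorm ℝ V} (hNM : IsDualPair N M) {d : ℝ}
    (hN1 : ∀ x, ‖x‖ ≤ N x) (hNd : ∀ x, N x ≤ d * ‖x‖) {m : ℕ} (hm : 1 ≤ m)
    (hd1 : 1 ≤ d) (hdm : d ^ 2 ≤ 4 ^ m) (f h : (ι → ℤˣ) → V) (hf : 𝔼 ε, N (f ε) ^ 2 ≤ 1)
    (hh : 𝔼 ε, M (h ε) ^ 2 ≤ 1) :
    ∑ i, ⟪walshCoeff {i} f, walshCoeff {i} h⟫ ≤ 14 * m ^ 2 := by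
  rcases isEmpty_or_nonempty ι with hι | hι
  · simp
  set a : ℕ → ℝ := fun k ↦ ∑ A ∈ Finset.powersetCard k (Finset.univ : Finset ι),
    ⟪walshCoeff A f, walshCoeff A h⟫ with ha
  have hsum : ∀ t : ℝ, ∑ k ∈ Finset.range (Fintype.card ι + 1), a k * t ^ k =
      ∑ A : Finset ι, t ^ A.card * ⟪walshCoeff A f, walshCoeff A h⟫ := by
    intro t
    rw [← Finset.powerset_univ, Finset.sum_powerset, Finset.card_univ]
    refine Finset.sum_congr rfl fun k _ ↦ ?_
    rw [ha, Finset.sum_mul]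
    refine Finset.sum_congr rfl fun A hA ↦ ?_
    rw [(Finset.mem_powersetCard.1 hA).2, mul_comm]
  have hbound : ∀ t : ℝ, |t| ≤ 1 →
      |∑ k ∈ Finset.range (Fintype.card ι + 1), a k * t ^ k| ≤ 1 := by
    intro t ht
    rw [hsum, sum_pow_mul_inner_walshCoeff]
    refine expect_add_sq_le hNM _ (fun ε η ↦ Finset.prod_nonneg fun i _ ↦ ?_)
      (fun ε ↦ expect_prod_one_add _) (fun η ↦ ?_) hf hh
    · have : |t * signReal (ε i) * signReal (η i)| ≤ 1 := by
        rw [abs_mul, abs_mul, abs_signReal, abs_signReal]; simpa using ht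
      linarith [(abs_le.1 this).1]
    · simp_rw [mul_right_comm t]
      exact expect_prod_one_add (fun i ↦ t * signReal (η i))
  have hcoef : ∀ k, |a k| ≤ d ^ 2 := by
    intro k
    have hF : 𝔼 ε, ‖f ε‖ ^ 2 ≤ 1 := by
      refine le_trans (Finset.expect_le_expect fun ε _ ↦ ?_) hf
      exact pow_le_pow_left₀ (norm_nonneg _) (hN1 _) 2
    have hH : 𝔼 ε, ‖h ε‖ ^ 2 ≤ d ^ 2 := by
      have : 𝔼 ε, ‖h ε‖ ^ 2 ≤ 𝔼 ε, d ^ 2 * M (h ε) ^ 2 := by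
        refine Finset.expect_le_expect fun ε _ ↦ ?_
        rw [← mul_pow]
        exact pow_le_pow_left₀ (norm_nonneg _) (hNM.le_right hNd _) 2
      rw [← Finset.mul_expect] at this
      nlinarith [sq_nonneg d]
    calc |a k| ≤ ∑ A ∈ Finset.powersetCard k (Finset.univ : Finset ι),
          |⟪walshCoeff A f, walshCoeff A h⟫| := Finset.abs_sum_le_sum_abs _ _
      _ ≤ ∑ A : Finset ι, |⟪walshCoeff A f, walshCoeff A h⟫| :=
          Finset.sum_le_sum_of_subset_of_nonneg (Finset.subset_univ _) fun _ _ _ ↦ abs_nonneg _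
      _ ≤ ∑ A : Finset ι, (‖walshCoeff A f‖ ^ 2 + ‖walshCoeff A h‖ ^ 2) / 2 :=
          Finset.sum_le_sum fun A _ ↦ (abs_real_inner_le_norm _ _).trans (by
            nlinarith [sq_nonneg (‖walshCoeff A f‖ - ‖walshCoeff A h‖)])
      _ = (𝔼 ε, ‖f ε‖ ^ 2 + 𝔼 ε, ‖h ε‖ ^ 2) / 2 := by
          rw [← Finset.sum_div, Finset.sum_add_distrib, sum_norm_walshCoeff_sq,
            sum_norm_walshCoeff_sq]
      _ ≤ d ^ 2 := by nlinarith
  have h1 := abs_coeff_one_le hm hdm a hcoef hbound Fintype.card_pos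
  have ha1 : a 1 = ∑ i, ⟪walshCoeff {i} f, walshCoeff {i} h⟫ := by
    rw [ha]
    simp [Finset.powersetCard_one]
  rw [← ha1]
  exact (le_abs_self _).trans h1

lemma vectorMean_smul {Ω : Type*} [Fintype Ω] (c : ℝ) (f : Ω → V) :
    vectorMean (fun ε ↦ c • f ε) = c • vectorMean f := by
  rw [vectorMean, vectorMean, ← Finset.smul_sum, smul_comm]

lemma walshCoeff_smul (c : ℝ) (A : Finset ι) (f : (ι → ℤˣ) → V) :
    walshCoeff A (fun ε ↦ c • f ε) = c • walshCoeff A f := by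
  unfold walshCoeff
  rw [← vectorMean_smul]
  simp_rw [smul_comm c]

/-- Boundedness of the Rademacher projection for a pair of dual norms, with a constant
logarithmic in the distance to the Euclidean norm. -/
lemma sum_inner_walshCoeff_le {N M : Seminorm ℝ V} (hNM : IsDualPair N M) {d : ℝ}
    (hN1 : ∀ x, ‖x‖ ≤ N x) (hNd : ∀ x, N x ≤ d * ‖x‖) {m : ℕ} (hm : 1 ≤ m)
    (hd1 : 1 ≤ d) (hdm : d ^ 2 ≤ 4 ^ m) (f h : (ι → ℤˣ) → V) {A B : ℝ} (hA : 0 < A) (hB : 0 < B)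
    (hf : 𝔼 ε, N (f ε) ^ 2 ≤ A ^ 2) (hh : 𝔼 ε, M (h ε) ^ 2 ≤ B ^ 2) :
    ∑ i, ⟪walshCoeff {i} f, walshCoeff {i} h⟫ ≤ 14 * m ^ 2 * A * B := by
  have hscale : ∀ (P : Seminorm ℝ V) (g : (ι → ℤˣ) → V) (R : ℝ), 0 < R →
      𝔼 ε, P (g ε) ^ 2 ≤ R ^ 2 → 𝔼 ε, P (R⁻¹ • g ε) ^ 2 ≤ 1 := by
    intro P g R hR hg
    simp_rw [map_smul_eq_mul, mul_pow, norm_inv, Real.norm_of_nonneg hR.le]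
    rw [← Finset.mul_expect, inv_pow, inv_mul_le_iff₀ (by positivity), mul_one]
    exact hg
  have h1 := sum_inner_walshCoeff_le_of_le_one (ι := ι) hNM hN1 hNd hm hd1 hdm
    (fun ε ↦ A⁻¹ • f ε) (fun ε ↦ B⁻¹ • h ε) (hscale N f A hA hf) (hscale M h B hB hh)
  simp_rw [walshCoeff_smul, real_inner_smul_left, real_inner_smul_right] at h1
  rw [← Finset.mul_sum, ← Finset.mul_sum, ← mul_assoc, ← mul_inv, inv_mul_le_iff₀ (by positivity)]
    at h1
  linarith

end KConvexity

section Lewis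

open scoped BigOperators RealInnerProductSpace

section

variable {ι : Type*} [Fintype ι] [DecidableEq ι] {V : Type*} [AddCommGroup V] [Module ℝ V]

lemma radSq_add_le (N : Seminorm ℝ V) (x w : ι → V) :
    radSq N (x + w) ≤ (√(radSq N x) + √(radSq N w)) ^ 2 := by
  have h1 : radSq N (x + w) ≤ radSq N x + radSq N w +
      2 * 𝔼 ε : ι → ℤˣ, N (∑ i, signReal (ε i) • x i) * N (∑ i, signReal (ε i) • w i) := by
    unfold radSq
    rw [Finset.mul_expect, ← Finset.expect_add_distrib, ← Finset.expect_add_distrib]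
    refine Finset.expect_le_expect fun ε _ ↦ ?_
    simp_rw [Pi.add_apply, smul_add, Finset.sum_add_distrib]
    have h := map_add_le_add N (∑ i, signReal (ε i) • x i) (∑ i, signReal (ε i) • w i)
    have h2 := pow_le_pow_left₀ (apply_nonneg N _) h 2
    linarith [h2]
  have h2 := Finset.expect_mul_sq_le_sq_mul_sq Finset.univ
    (fun ε : ι → ℤˣ ↦ N (∑ i, signReal (ε i) • x i)) (fun ε ↦ N (∑ i, signReal (ε i) • w i))
  have h3 : 𝔼 ε : ι → ℤˣ, N (∑ i, signReal (ε i) • x i) * N (∑ i, signReal (ε i) • w i) ≤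
      √(radSq N x) * √(radSq N w) := by
    rw [← Real.sqrt_mul (radSq_nonneg N x)]
    exact Real.le_sqrt_of_sq_le h2
  rw [add_sq, Real.sq_sqrt (radSq_nonneg N x), Real.sq_sqrt (radSq_nonneg N w)]
  linarith

lemma radSq_smul (N : Seminorm ℝ V) (t : ℝ) (x : ι → V) :
    radSq N (t • x) = t ^ 2 * radSq N x := by
  unfold radSq
  rw [Finset.mul_expect]
  refine Finset.expect_congr rfl fun ε _ ↦ ?_
  rw [show ∑ i, signReal (ε i) • (t • x) i = t • ∑ i, signReal (ε i) • x i by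
      rw [Finset.smul_sum]; exact Finset.sum_congr rfl fun i _ ↦ smul_comm _ _ _,
      map_smul_eq_mul, mul_pow, Real.norm_eq_abs, sq_abs]

end

lemma continuous_radSq {ι : Type*} [Fintype ι] [DecidableEq ι] {V : Type*} [NormedAddCommGroup V]
    [InnerProductSpace ℝ V] [FiniteDimensional ℝ V] (N : Seminorm ℝ V) :
    Continuous (radSq N : (ι → V) → ℝ) := by
  have hN := N.continuous_of_finiteDimensional'
  unfold radSq
  simp_rw [Finset.expect_eq_sum_div_card]
  fun_prop

lemma trace_le_of_det_le {n : ℕ} (A : Matrix (Fin n) (Fin n) ℝ) {a : ℝ}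
    (h : ∀ t : ℝ, 0 ≤ t → (1 + t • A).det ≤ (1 + t * a) ^ n) : A.trace ≤ n * a := by
  set p : Polynomial ℝ := (1 + (Polynomial.X : Polynomial ℝ) • A.map Polynomial.C).det with hp
  have heval : ∀ t, p.eval t = (1 + t • A).det := by
    intro t
    rw [hp, ← Polynomial.coe_evalRingHom, RingHom.map_det]
    congr 1
    ext i j
    simp [Matrix.one_apply, apply_ite, Matrix.map_apply, mul_comm t]
  have hd := (p.hasDerivAt 0)
  rw [hp, Matrix.derivative_det_one_add_X_smul, ← hp] at hd
  have hq : HasDerivAt (fun t : ℝ ↦ (1 + t * a) ^ n) (n * a) 0 := by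
    have := (((hasDerivAt_id (0 : ℝ)).mul_const a).const_add 1).pow n
    refine HasDerivAt.congr_deriv this ?_
    simp
  have hφ := (hq.sub hd).hasDerivWithinAt (s := Set.Ioi 0)
  rw [hasDerivWithinAt_iff_tendsto_slope' (by simp)] at hφ
  have := ge_of_tendsto hφ (b := 0) (by
    filter_upwards [self_mem_nhdsWithin] with t ht
    have ht : 0 < t := ht
    have h1 := h t ht.le
    rw [slope_def_field]
    refine div_nonneg ?_ (by linarith)
    simp only [Pi.sub_apply, heval]
    simp
    exact h1)
  linarith

/-- Lewis's theorem for the Rademacher norm. -/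
theorem exists_lewis_position {n : ℕ} (N : Seminorm ℝ (EuclideanSpace ℝ (Fin n))) {c : ℝ}
    (hc : 0 < c) (hN : ∀ x, c * ‖x‖ ≤ N x) :
    ∃ x y : Fin n → EuclideanSpace ℝ (Fin n), (∀ i j, ⟪x i, y j⟫ = if i = j then 1 else 0) ∧
      radSq N x ≤ 1 ∧ ∀ w : Fin n → EuclideanSpace ℝ (Fin n),
        ∑ i, ⟪y i, w i⟫ ≤ n * √(radSq N w) := by
  set mat : (Fin n → EuclideanSpace ℝ (Fin n)) → Matrix (Fin n) (Fin n) ℝ :=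
    fun x ↦ Matrix.of fun i j ↦ x i j with hmat
  have hmc : Continuous fun x ↦ |(mat x).det| := by
    refine continuous_abs.comp (Continuous.matrix_det ?_)
    refine continuous_matrix fun i j ↦ ?_
    simp only [hmat, Matrix.of_apply]
    fun_prop
  set S : Set (Fin n → EuclideanSpace ℝ (Fin n)) := {x | radSq N x ≤ 1} with hS
  have hScomp : IsCompact S := by
    refine Metric.isCompact_of_isClosed_isBounded
      (isClosed_le (continuous_radSq N) continuous_const) ?_
    refine (Metric.isBounded_iff_subset_closedBall 0).2 ⟨c⁻¹, fun x hx ↦ ?_⟩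
    rw [mem_closedBall_zero_iff, pi_norm_le_iff_of_nonneg (by positivity)]
    intro j
    have h1 := (sq_le_radSq N x j).trans hx
    have h2 : N (x j) ≤ 1 := by
      have := apply_nonneg N (x j)
      nlinarith
    rw [← one_div, le_div_iff₀ hc, mul_comm]
    exact (hN _).trans h2
  obtain ⟨x, hxS, hxmax⟩ := hScomp.exists_isMaxOn ⟨0, by simp [hS, radSq]⟩ hmc.continuousOn
  have hmats : ∀ (t : ℝ) z, mat (t • z) = t • mat z := fun t z ↦ by ext i j; simp [hmat]
  have hhom : ∀ z (s : ℝ), 0 < s → radSq N z ≤ s ^ 2 → |(mat z).det| ≤ s ^ n * |(mat x).det| := by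
    intro z s hs hz
    have h1 : s⁻¹ • z ∈ S := by
      rw [hS, Set.mem_ofPred_eq, radSq_smul, inv_pow, inv_mul_le_iff₀ (by positivity), mul_one]
      exact hz
    have h2 := hxmax h1
    simp only [Set.mem_ofPred_eq, hmats, Matrix.det_smul, Fintype.card_fin, abs_mul, abs_pow,
      abs_inv, abs_of_pos hs, inv_pow] at h2
    rwa [inv_mul_le_iff₀ (by positivity)] at h2
  have hdet : (mat x).det ≠ 0 := by
    intro h0
    have h1 := hhom (fun i ↦ EuclideanSpace.single i 1)
      (√(radSq N (fun i : Fin n ↦ EuclideanSpace.single i (1 : ℝ))) + 1)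
      (by positivity) (by
        have := Real.sq_sqrt (radSq_nonneg N (fun i : Fin n ↦ EuclideanSpace.single i (1 : ℝ)))
        nlinarith [Real.sqrt_nonneg
          (radSq N (fun i : Fin n ↦ EuclideanSpace.single i (1 : ℝ)))])
    have h2 : mat (fun i ↦ EuclideanSpace.single i 1) = 1 := by
      ext i j
      simp [hmat, Matrix.one_apply, eq_comm]
    rw [h2, h0, Matrix.det_one] at h1
    norm_num at h1
  have hunit : IsUnit (mat x).det := isUnit_iff_ne_zero.2 hdet
  set y : Fin n → EuclideanSpace ℝ (Fin n) := fun j ↦ WithLp.toLp 2 fun k ↦ (mat x)⁻¹ k j with hy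
  refine ⟨x, y, fun i j ↦ ?_, hxS, fun w ↦ ?_⟩
  · rw [← Matrix.one_apply, ← Matrix.mul_nonsing_inv _ hunit, Matrix.mul_apply, PiLp.inner_apply]
    refine Finset.sum_congr rfl fun k _ ↦ ?_
    simp [hy, hmat, mul_comm]
  · have htr : ∑ i, ⟪y i, w i⟫ = ((mat x)⁻¹ * mat w).trace := by
      simp_rw [Matrix.trace, Matrix.diag, Matrix.mul_apply, PiLp.inner_apply]
      rw [Finset.sum_comm]
      refine Finset.sum_congr rfl fun i _ ↦ Finset.sum_congr rfl fun k _ ↦ ?_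
      simp [hy, hmat, mul_comm]
    rw [htr]
    refine trace_le_of_det_le _ fun t ht ↦ ?_
    have hrad : radSq N (x + t • w) ≤ (1 + t * √(radSq N w)) ^ 2 := by
      refine (radSq_add_le N x (t • w)).trans ?_
      rw [radSq_smul, Real.sqrt_mul (sq_nonneg t), Real.sqrt_sq ht]
      have : √(radSq N x) ≤ 1 := Real.sqrt_le_one.2 hxS
      gcongr
    have h1 := hhom _ _ (by positivity) hrad
    have h2 : mat (x + t • w) = mat x * (1 + t • ((mat x)⁻¹ * mat w)) := by
      rw [mul_add, mul_one, Matrix.mul_smul, ← mul_assoc, Matrix.mul_nonsing_inv _ hunit, one_mul]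
      ext i j
      simp [hmat]
    rw [h2, Matrix.det_mul, abs_mul, mul_comm] at h1
    exact (le_abs_self _).trans (le_of_mul_le_mul_right h1 (abs_pos.2 hdet))

end Lewis

section RademacherAverages

open scoped BigOperators RealInnerProductSpace

variable {ι : Type*} [Fintype ι] [DecidableEq ι]
variable {V : Type*} [NormedAddCommGroup V] [InnerProductSpace ℝ V]

lemma expect_signReal_mul_signReal (i j : ι) :
    𝔼 ε : ι → ℤˣ, signReal (ε i) * signReal (ε j) = if i = j then 1 else 0 := by
  split_ifs with hij
  · subst hij
    simp_rw [signReal_mul_self]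
    rw [Finset.expect_const Finset.univ_nonempty]
  · have h0 := expect_prod_one_add_mul (fun _ : ι ↦ (0 : ℝ)) j
    have h1 := expect_prod_one_add_mul (fun k : ι ↦ if k = i then (1 : ℝ) else 0) j
    have h2 : ∀ η : ι → ℤˣ, ∏ k, (1 + (if k = i then (1 : ℝ) else 0) * signReal (η k)) =
        1 + signReal (η i) := by
      intro η
      rw [Finset.prod_eq_single i]
      · simp
      · intro k _ hk; simp [hk]
      · simp
    simp_rw [h2, add_mul, one_mul, Finset.expect_add_distrib, if_neg (Ne.symm hij)] at h1
    simp only [zero_mul, add_zero, Finset.prod_const_one, one_mul] at h0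
    linarith

lemma expect_norm_sq_signs (z : ι → V) :
    𝔼 ε : ι → ℤˣ, ‖∑ i, signReal (ε i) • z i‖ ^ 2 = ∑ i, ‖z i‖ ^ 2 := by
  have : ∀ ε : ι → ℤˣ, ‖∑ i, signReal (ε i) • z i‖ ^ 2 =
      ∑ i, ∑ j, signReal (ε i) * signReal (ε j) * ⟪z i, z j⟫ := by
    intro ε
    rw [← real_inner_self_eq_norm_sq, sum_inner]
    refine Finset.sum_congr rfl fun i _ ↦ ?_
    rw [inner_sum]
    refine Finset.sum_congr rfl fun j _ ↦ ?_
    rw [real_inner_smul_left, real_inner_smul_right]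
    ring
  simp_rw [this, Finset.expect_sum_comm, ← Finset.expect_mul, expect_signReal_mul_signReal]
  refine Finset.sum_congr rfl fun i _ ↦ ?_
  simp

lemma sum_norm_sq_le_radSq {N : Seminorm ℝ V} {c : ℝ} (hc : 0 ≤ c) (hN : ∀ x, c * ‖x‖ ≤ N x)
    (z : ι → V) : c ^ 2 * ∑ i, ‖z i‖ ^ 2 ≤ radSq N z := by
  rw [← expect_norm_sq_signs, Finset.mul_expect, radSq]
  refine Finset.expect_le_expect fun ε _ ↦ ?_
  rw [← mul_pow]
  exact pow_le_pow_left₀ (by positivity) (hN _) 2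

lemma radSq_le_sum_norm_sq {N : Seminorm ℝ V} {c : ℝ} (hN : ∀ x, N x ≤ c * ‖x‖)
    (z : ι → V) : radSq N z ≤ c ^ 2 * ∑ i, ‖z i‖ ^ 2 := by
  rw [← expect_norm_sq_signs, Finset.mul_expect, radSq]
  refine Finset.expect_le_expect fun ε _ ↦ ?_
  rw [← mul_pow]
  exact pow_le_pow_left₀ (apply_nonneg _ _) (hN _) 2

lemma walsh_singleton {ι : Type*} (i : ι) (ε : ι → ℤˣ) : walsh {i} ε = signReal (ε i) :=
  Finset.prod_singleton _ _

lemma expect_inner_signs (f : (ι → ℤˣ) → V) (y : ι → V) :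
    𝔼 ε, ⟪f ε, ∑ i, signReal (ε i) • y i⟫ = ∑ i, ⟪walshCoeff {i} f, y i⟫ := by
  simp_rw [inner_walshCoeff_left, walsh_singleton, inner_sum, real_inner_smul_right,
    Finset.expect_sum_comm]

section Dual

variable {N M : Seminorm ℝ V} {d : ℝ} {m : ℕ}

lemma radSq_walshCoeff_le (hNM : IsDualPair N M)
    (hN1 : ∀ x, ‖x‖ ≤ N x) (hNd : ∀ x, N x ≤ d * ‖x‖) (hm : 1 ≤ m)
    (hd1 : 1 ≤ d) (hdm : d ^ 2 ≤ 4 ^ m) (f : (ι → ℤˣ) → V) {A : ℝ} (hA : 0 < A)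
    (hf : 𝔼 ε, N (f ε) ^ 2 ≤ A ^ 2) :
    √(radSq N fun i ↦ walshCoeff {i} f) ≤ 14 * m ^ 2 * A := by
  set w : ι → V := fun i ↦ walshCoeff {i} f with hw
  rcases (radSq_nonneg N w).eq_or_lt with h0 | h0
  · rw [← h0, Real.sqrt_zero]; positivity
  choose g hg1 hg2 using hNM.exists_right
  set h : (ι → ℤˣ) → V := fun ε ↦
    N (∑ i, signReal (ε i) • w i) • g (∑ i, signReal (ε i) • w i) with hh
  have hM : 𝔼 ε, M (h ε) ^ 2 ≤ √(radSq N w) ^ 2 := by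
    rw [Real.sq_sqrt h0.le, radSq]
    refine Finset.expect_le_expect fun ε _ ↦ pow_le_pow_left₀ (apply_nonneg _ _) ?_ 2
    rw [hh, map_smul_eq_mul, Real.norm_of_nonneg (apply_nonneg _ _)]
    exact mul_le_of_le_one_right (apply_nonneg _ _) (hg1 _)
  have h1 := sum_inner_walshCoeff_le hNM hN1 hNd hm hd1 hdm f h hA (Real.sqrt_pos.2 h0) hf hM
  have h2 : ∑ i, ⟪walshCoeff {i} f, walshCoeff {i} h⟫ = radSq N w := by
    have : ∀ i : ι, ⟪walshCoeff {i} f, walshCoeff {i} h⟫ = ⟪walshCoeff {i} h, w i⟫ :=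
      fun i ↦ real_inner_comm _ _
    simp_rw [this]
    rw [← expect_inner_signs, radSq]
    refine Finset.expect_congr rfl fun ε _ ↦ ?_
    rw [hh, real_inner_smul_left, real_inner_comm, hg2, sq]
  rw [h2] at h1
  refine le_of_mul_le_mul_right ?_ (Real.sqrt_pos.2 h0)
  rwa [Real.mul_self_sqrt h0.le]

lemma sqrt_radSq_dual_le (hNM : IsDualPair N M)
    (hN1 : ∀ x, ‖x‖ ≤ N x) (hNd : ∀ x, N x ≤ d * ‖x‖) (hm : 1 ≤ m)
    (hd1 : 1 ≤ d) (hdm : d ^ 2 ≤ 4 ^ m) {y : ι → V} {n : ℝ} (hn : 0 ≤ n)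
    (hy : ∀ w : ι → V, ∑ i, ⟪y i, w i⟫ ≤ n * √(radSq N w)) :
    √(radSq M y) ≤ n * (14 * m ^ 2) := by
  rcases (radSq_nonneg M y).eq_or_lt with h0 | h0
  · rw [← h0, Real.sqrt_zero]; positivity
  choose g hg1 hg2 using hNM.exists_left
  set f : (ι → ℤˣ) → V := fun ε ↦
    M (∑ i, signReal (ε i) • y i) • g (∑ i, signReal (ε i) • y i) with hf
  have hM : 𝔼 ε, N (f ε) ^ 2 ≤ √(radSq M y) ^ 2 := by
    rw [Real.sq_sqrt h0.le, radSq]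
    refine Finset.expect_le_expect fun ε _ ↦ pow_le_pow_left₀ (apply_nonneg _ _) ?_ 2
    rw [hf, map_smul_eq_mul, Real.norm_of_nonneg (apply_nonneg _ _)]
    exact mul_le_of_le_one_right (apply_nonneg _ _) (hg1 _)
  have h1 := radSq_walshCoeff_le hNM hN1 hNd hm hd1 hdm f (Real.sqrt_pos.2 h0) hM
  have h2 : ∑ i, ⟪y i, walshCoeff {i} f⟫ = radSq M y := by
    simp_rw [real_inner_comm (walshCoeff _ f)]
    rw [← expect_inner_signs, radSq]
    refine Finset.expect_congr rfl fun ε _ ↦ ?_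
    rw [hf, real_inner_smul_left, hg2, sq]
  have h3 := hy fun i ↦ walshCoeff {i} f
  rw [h2, ← Real.mul_self_sqrt h0.le] at h3
  refine le_of_mul_le_mul_right (h3.trans ?_) (Real.sqrt_pos.2 h0)
  rw [mul_assoc]
  exact mul_le_mul_of_nonneg_left h1 hn

end Dual

end RademacherAverages

section GaussianAverages

open ProbabilityTheory
open scoped BigOperators RealInnerProductSpace

variable {ι : Type*} [Fintype ι] [DecidableEq ι]
variable {V : Type*} [NormedAddCommGroup V] [InnerProductSpace ℝ V]

/-- The linear map with the given values on the standard basis of a Euclidean space. -/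
noncomputable def euclideanSum (x : ι → V) : EuclideanSpace ℝ ι →ₗ[ℝ] V where
  toFun g := ∑ i, g i • x i
  map_add' g h := by simp [add_smul, Finset.sum_add_distrib]
  map_smul' c g := by simp [mul_smul, Finset.smul_sum]

lemma euclideanSum_apply {ι : Type*} [Fintype ι] (x : ι → V) (g : EuclideanSpace ℝ ι) :
    euclideanSum x g = ∑ i, g i • x i := rfl

lemma integral_seminorm_sq_flip {ι : Type*} [Fintype ι] (P : Seminorm ℝ (EuclideanSpace ℝ ι)) (ε : ι → ℤˣ) :
    ∫ g, P (WithLp.toLp 2 fun i ↦ signReal (ε i) * g i) ^ 2 ∂(stdGaussian (EuclideanSpace ℝ ι)) =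
      ∫ g, P g ^ 2 ∂(stdGaussian (EuclideanSpace ℝ ι)) := by
  set e : EuclideanSpace ℝ ι ≃ₗᵢ[ℝ] EuclideanSpace ℝ ι := LinearIsometryEquiv.piLpCongrRight 2
    (fun i ↦ if ε i = 1 then LinearIsometryEquiv.refl ℝ ℝ else LinearIsometryEquiv.neg ℝ) with he
  have heg : ∀ g, e g = WithLp.toLp 2 fun i ↦ signReal (ε i) * g i := by
    intro g
    rw [he, LinearIsometryEquiv.piLpCongrRight_apply]
    congr 1
    ext i
    rcases Int.units_eq_one_or (ε i) with h | h <;> simp [h]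
  have hP := P.continuous_of_finiteDimensional'
  conv_rhs => rw [← stdGaussian_map e]
  rw [integral_map (f := fun g ↦ P g ^ 2) e.continuous.aemeasurable
    (hP.pow 2).aestronglyMeasurable]
  simp_rw [heg]

lemma integral_euclideanSum_eq [FiniteDimensional ℝ V] (N : Seminorm ℝ V) (x : ι → V) :
    ∫ g, N (euclideanSum x g) ^ 2 ∂(stdGaussian (EuclideanSpace ℝ ι)) =
      ∫ g, radSq N (fun i ↦ g i • x i) ∂(stdGaussian (EuclideanSpace ℝ ι)) := by
  set P := N.comp (euclideanSum x) with hP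
  have h1 := integral_seminorm_sq_flip P
  have hPc := P.continuous_of_finiteDimensional'
  have hflip : ∀ ε : ι → ℤˣ, Integrable (fun g : EuclideanSpace ℝ ι ↦
      P (WithLp.toLp 2 fun i ↦ signReal (ε i) * g i) ^ 2) (stdGaussian (EuclideanSpace ℝ ι)) := by
    intro ε
    set L : EuclideanSpace ℝ ι →ₗ[ℝ] EuclideanSpace ℝ ι :=
      { toFun := fun g ↦ WithLp.toLp 2 fun i ↦ signReal (ε i) * g i
        map_add' := fun g h ↦ by ext i; simp [mul_add]
        map_smul' := fun c g ↦ by ext i; simp [mul_left_comm] } with hL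
    exact (P.comp L).integrable_sq_stdGaussian
  have h2 : ∀ g : EuclideanSpace ℝ ι, radSq N (fun i ↦ g i • x i) =
      (∑ ε : ι → ℤˣ, P (WithLp.toLp 2 fun i ↦ signReal (ε i) * g i) ^ 2) /
        (Finset.univ : Finset (ι → ℤˣ)).card := by
    intro g
    rw [radSq, Finset.expect_eq_sum_div_card]
    simp [hP, euclideanSum_apply, mul_smul]
  simp_rw [h2]
  rw [integral_div, integral_finsetSum _ fun ε _ ↦ hflip ε]
  simp_rw [h1]
  rw [Finset.sum_const, nsmul_eq_mul, mul_div_cancel_left₀]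
  · rfl
  · simp

lemma sq_le_eight_mul_exp (u t : ℝ) (h : t ≤ u ^ 2) :
    u ^ 2 ≤ 8 * Real.exp (-t / 8) * Real.exp (1 / 4 * u ^ 2) := by
  have h1 := Real.add_one_le_exp (u ^ 2 / 8)
  have h2 : Real.exp (u ^ 2 / 8) ≤ Real.exp (-t / 8) * Real.exp (1 / 4 * u ^ 2) := by
    rw [← Real.exp_add]
    exact Real.exp_le_exp.2 (by linarith)
  nlinarith

/-- Gaussian averages are bounded by Rademacher averages, up to a logarithmic factor in the
distance to the Euclidean norm. -/
lemma integral_euclideanSum_le [FiniteDimensional ℝ V] (N : Seminorm ℝ V) {c d : ℝ} (hc : 0 < c)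
    (hd : 1 ≤ d) (hN1 : ∀ x, c * ‖x‖ ≤ N x) (hNd : ∀ x, N x ≤ c * d * ‖x‖) (x : ι → V) :
    ∫ g, N (euclideanSum x g) ^ 2 ∂(stdGaussian (EuclideanSpace ℝ ι)) ≤
      32 * (1 + Real.log d) * radSq N x := by
  have hlog := Real.log_nonneg hd
  obtain ⟨T, hT⟩ : ∃ T : ℝ, T = 16 * Real.log d := ⟨_, rfl⟩
  have hT0 : 0 ≤ T := by rw [hT]; positivity
  have hexpT : Real.exp (-T / 8) = (d ^ 2)⁻¹ := by
    rw [hT, show -(16 * Real.log d) / 8 = -(2 * Real.log d) by ring, Real.exp_neg]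
    congr 1
    rw [two_mul, Real.exp_add, Real.exp_log (by linarith), sq]
  rw [integral_euclideanSum_eq]
  have hpt : ∀ g : EuclideanSpace ℝ ι, radSq N (fun i ↦ g i • x i) ≤
      2 * (T * radSq N x) + 2 * ((c * d) ^ 2 * ∑ i, 8 * Real.exp (-T / 8) *
        Real.exp (1 / 4 * g i ^ 2) * ‖x i‖ ^ 2) := by
    intro g
    obtain ⟨a, ha⟩ : ∃ a : ι → ℝ, a = fun i ↦ if g i ^ 2 ≤ T then g i else 0 := ⟨_, rfl⟩
    obtain ⟨b, hb⟩ : ∃ b : ι → ℝ, b = fun i ↦ if g i ^ 2 ≤ T then 0 else g i := ⟨_, rfl⟩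
    have hab : (fun i ↦ g i • x i) = (fun i ↦ a i • x i) + fun i ↦ b i • x i := by
      ext i
      simp only [Pi.add_apply, ha, hb]
      split_ifs <;> simp
    rw [hab]
    have h1 := radSq_add_le N (fun i ↦ a i • x i) (fun i ↦ b i • x i)
    have h2 : radSq N (fun i ↦ a i • x i) ≤ T * radSq N x := by
      have := radSq_smul_le N x (Real.sqrt_nonneg T) (a := a) (fun i ↦ by
        rw [ha]
        dsimp only
        split_ifs with h
        · exact Real.abs_le_sqrt h
        · simp)
      rwa [Real.sq_sqrt hT0] at this
    have h3 : radSq N (fun i ↦ b i • x i) ≤ (c * d) ^ 2 * ∑ i, 8 * Real.exp (-T / 8) *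
        Real.exp (1 / 4 * g i ^ 2) * ‖x i‖ ^ 2 := by
      refine (radSq_le_sum_norm_sq hNd _).trans ?_
      gcongr with i
      rw [norm_smul, mul_pow, Real.norm_eq_abs, sq_abs]
      gcongr
      rw [hb]
      dsimp only
      split_ifs with h
      · rw [sq, zero_mul]; positivity
      · exact sq_le_eight_mul_exp _ _ (not_le.1 h).le
    have h4 := Real.sq_sqrt (radSq_nonneg N fun i ↦ a i • x i)
    have h5 := Real.sq_sqrt (radSq_nonneg N fun i ↦ b i • x i)
    nlinarith [sq_nonneg (√(radSq N fun i ↦ a i • x i) - √(radSq N fun i ↦ b i • x i))]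
  have hexpi : ∀ i : ι, ∫ g : EuclideanSpace ℝ ι, Real.exp (1 / 4 * g i ^ 2)
      ∂(stdGaussian (EuclideanSpace ℝ ι)) = √2 := by
    intro i
    have h := integral_exp_mul_inner_sq_stdGaussian (V := EuclideanSpace ℝ ι)
      (y := EuclideanSpace.single i 1) (by simp) (s := 1 / 4) (by norm_num)
    simp only [EuclideanSpace.inner_single_left, map_one, one_mul] at h
    rw [h, ← Real.sqrt_inv]
    norm_num
  have hinti : ∀ i : ι, Integrable (fun g : EuclideanSpace ℝ ι ↦ Real.exp (1 / 4 * g i ^ 2))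
      (stdGaussian (EuclideanSpace ℝ ι)) := by
    intro i
    refine .of_integral_ne_zero ?_
    rw [hexpi]
    positivity
  have hint2 : Integrable (fun g : EuclideanSpace ℝ ι ↦ ∑ i, 8 * Real.exp (-T / 8) *
        Real.exp (1 / 4 * g i ^ 2) * ‖x i‖ ^ 2) (stdGaussian (EuclideanSpace ℝ ι)) :=
    integrable_finsetSum _ fun i _ ↦ ((hinti i).const_mul _).mul_const _
  have hsum := sum_norm_sq_le_radSq hc.le hN1 x
  refine (integral_mono_of_nonneg (ae_of_all _ fun g ↦ radSq_nonneg N _)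
    ((integrable_const _).add ((hint2.const_mul _).const_mul _)) (ae_of_all _ hpt)).trans ?_
  simp only [Pi.add_apply]
  rw [integral_add (integrable_const _) ((hint2.const_mul _).const_mul _), integral_const,
    integral_const_mul, integral_const_mul,
    integral_finsetSum _ fun i _ ↦ ((hinti i).const_mul _).mul_const _]
  simp_rw [integral_mul_const, integral_const_mul, hexpi]
  rw [← Finset.mul_sum, hexpT, probReal_univ, one_smul]
  have hd0 : d ≠ 0 := by linarith
  rw [show 2 * ((c * d) ^ 2 * (8 * (d ^ 2)⁻¹ * √2 * ∑ i, ‖x i‖ ^ 2)) =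
    16 * √2 * (c ^ 2 * ∑ i, ‖x i‖ ^ 2) by field_simp; ring]
  have hs2 : √2 ≤ 2 := by rw [Real.sqrt_le_left (by norm_num)]; norm_num
  have hr := radSq_nonneg N x
  have : 16 * √2 * (c ^ 2 * ∑ i, ‖x i‖ ^ 2) ≤ 16 * 2 * radSq N x := by gcongr
  rw [hT]
  linarith

end GaussianAverages

section QuotientOfSubspace

open ProbabilityTheory
open scoped RealInnerProductSpace

variable {V : Type*} [NormedAddCommGroup V] [InnerProductSpace ℝ V] [FiniteDimensional ℝ V]
  [MeasurableSpace V] [BorelSpace V]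

lemma map_orthogonalProjectionOnto_stdGaussian (F : Submodule ℝ V) :
    (stdGaussian V).map F.orthogonalProjectionOnto = stdGaussian F := by
  apply Measure.ext_of_charFun
  ext t
  have h : charFun ((stdGaussian V).map F.orthogonalProjectionOnto) t =
      charFun (stdGaussian V) (t : V) := by
    rw [charFun_apply, charFun_apply, integral_map (by fun_prop)
      (Measurable.aestronglyMeasurable (by fun_prop))]
    simp_rw [F.inner_orthogonalProjectionOnto_eq_of_mem_right]
  rw [h, charFun_stdGaussian, charFun_stdGaussian, Submodule.coe_norm]

lemma integral_sq_comp_subtype_le (N : Seminorm ℝ V) (F : Submodule ℝ V) :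
    ∫ v, N.comp F.subtype v ^ 2 ∂(stdGaussian F) ≤ ∫ v, N v ^ 2 ∂(stdGaussian V) := by
  have hN := N.continuous_of_finiteDimensional'
  have hr : ∫ v, N (F.reflection v) ^ 2 ∂(stdGaussian V) = ∫ v, N v ^ 2 ∂(stdGaussian V) := by
    conv_rhs => rw [← stdGaussian_map F.reflection]
    rw [integral_map (f := fun g ↦ N g ^ 2) F.reflection.continuous.aemeasurable
      (hN.pow 2).aestronglyMeasurable]
  have hri : Integrable (fun v ↦ N (F.reflection v) ^ 2) (stdGaussian V) :=
    (N.comp F.reflection.toLinearEquiv.toLinearMap).integrable_sq_stdGaussian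
  have hi := N.integrable_sq_stdGaussian
  rw [← map_orthogonalProjectionOnto_stdGaussian,
    integral_map (f := fun v ↦ N.comp F.subtype v ^ 2) (by fun_prop)
    ((N.comp F.subtype).continuous_of_finiteDimensional'.pow 2).aestronglyMeasurable]
  calc ∫ v, N.comp F.subtype (F.orthogonalProjectionOnto v) ^ 2 ∂(stdGaussian V)
    _ ≤ ∫ v, (N v ^ 2 / 2 + N (F.reflection v) ^ 2 / 2) ∂(stdGaussian V) := by
      refine integral_mono_of_nonneg (ae_of_all _ fun v ↦ sq_nonneg _)
        ((hi.div_const 2).add (hri.div_const 2)) (ae_of_all _ fun v ↦ ?_)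
      have h1 : (F.orthogonalProjectionOnto v : V) = (2⁻¹ : ℝ) • (v + F.reflection v) := by
        rw [Submodule.reflection_apply, add_sub_cancel, two_nsmul, ← two_smul ℝ, smul_smul]
        norm_num
      have h2 : N.comp F.subtype (F.orthogonalProjectionOnto v) ≤
          2⁻¹ * (N v + N (F.reflection v)) := by
        rw [Seminorm.comp_apply, Submodule.subtype_apply, h1, map_smul_eq_mul]
        norm_num
        exact map_add_le_add N _ _
      have h3 := pow_le_pow_left₀ (apply_nonneg _ _) h2 2
      dsimp only
      nlinarith [sq_nonneg (N v - N (F.reflection v))]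
    _ = ∫ v, N v ^ 2 ∂(stdGaussian V) := by
      rw [integral_add (hi.div_const 2) (hri.div_const 2), integral_div, integral_div, hr]
      ring

/-- `N` is equivalent to a multiple of the Euclidean norm, with ratio of the constants at
most `d`. -/
def Seminorm.IsRound {V : Type*} [NormedAddCommGroup V] [InnerProductSpace ℝ V]
    (N : Seminorm ℝ V) (d : ℝ) : Prop :=
  ∃ c : ℝ, 0 < c ∧ ∀ x, c * ‖x‖ ≤ N x ∧ N x ≤ c * d * ‖x‖

lemma Seminorm.IsRound.mono {V : Type*} [NormedAddCommGroup V] [InnerProductSpace ℝ V]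
    {N : Seminorm ℝ V} {d d' : ℝ} (h : N.IsRound d) (hd : d ≤ d') : N.IsRound d' := by
  obtain ⟨c, hc, h⟩ := h
  exact ⟨c, hc, fun x ↦ ⟨(h x).1, (h x).2.trans (by gcongr)⟩⟩

/-- A seminorm on a finite-dimensional inner product space can be transported to a standard
Euclidean space. -/
lemma Seminorm.IsRound.exists_euclidean {V : Type*} [NormedAddCommGroup V] [InnerProductSpace ℝ V]
    [FiniteDimensional ℝ V] {N : Seminorm ℝ V} {d : ℝ} (h : N.IsRound d) :
    ∃ M : Seminorm ℝ (EuclideanSpace ℝ (Fin (Module.finrank ℝ V))),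
      IsSubquotient N M ∧ M.IsRound d := by
  obtain ⟨c, hc, h⟩ := h
  refine ⟨_, IsSubquotient.comp_equiv N (stdOrthonormalBasis ℝ V).repr.symm.toLinearEquiv, c, hc,
    fun x ↦ ?_⟩
  have := h ((stdOrthonormalBasis ℝ V).repr.symm x)
  rw [LinearIsometryEquiv.norm_map] at this
  exact this

/-- The quotient of subspace theorem, with roundness controlled by the product of the Gaussian
averages of a norm and its dual. -/
theorem exists_isRound_of_isDualPair {N M : Seminorm ℝ V} (h : IsDualPair N M) {a b c : ℝ}
    (hV : 0 < Module.finrank ℝ V) (hc : 0 < c) (hN : ∀ x, c * ‖x‖ ≤ N x) (ha : 0 < a) (hb : 0 < b)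
    (hNa : ∫ v, N v ^ 2 ∂(stdGaussian V) ≤ a ^ 2) (hMb : ∫ v, M v ^ 2 ∂(stdGaussian V) ≤ b ^ 2) :
    ∃ (k : ℕ) (N' : Seminorm ℝ (EuclideanSpace ℝ (Fin k))), Module.finrank ℝ V ≤ 4 * k ∧
      IsSubquotient N N' ∧ N'.IsRound (2 ^ 39 * (a * b) / Module.finrank ℝ V) := by
  obtain ⟨F, hF, hFb⟩ := exists_submodule_polar_le M hb hMb
  obtain ⟨n, hn⟩ : ∃ n : ℝ, n = Module.finrank ℝ V := ⟨_, rfl⟩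
  obtain ⟨n', hn'⟩ : ∃ n' : ℝ, n' = Module.finrank ℝ F := ⟨_, rfl⟩
  have hn0 : 0 < n := by rw [hn]; exact_mod_cast hV
  have hnn' : n ≤ 2 * n' := by rw [hn, hn']; exact_mod_cast hF
  have hn'0 : 0 < n' := by linarith
  have hsn := Real.sqrt_pos.2 hn0
  have hsn' := Real.sqrt_pos.2 hn'0
  rw [← hn] at hFb ⊢
  have hscale : ∀ {W : Type _} [NormedAddCommGroup W] [InnerProductSpace ℝ W]
      {P Q : Seminorm ℝ W} {x : W} {s r : ℝ}, IsDualPair P Q → 0 < P x →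
      (∀ t : ℝ, (∀ y, ⟪t • x, y⟫ ≤ Q y) → ‖t • x‖ * s ≤ r) → s * ‖x‖ ≤ r * P x := by
    intro W _ _ P Q x s r hPQ hP0 hpol
    have h1 := hpol (P x)⁻¹ fun y ↦ by
      rw [real_inner_smul_left, inv_mul_le_iff₀ hP0]
      exact hPQ.inner_le x y
    rw [norm_smul, norm_inv, Real.norm_of_nonneg hP0.le, mul_assoc, inv_mul_le_iff₀ hP0] at h1
    linarith
  have hFN : ∀ x : F, √n / (2 ^ 19 * b) * ‖x‖ ≤ N.comp F.subtype x := by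
    intro x
    rcases eq_or_ne x 0 with rfl | hx
    · simp
    have hNx : 0 < N x := lt_of_lt_of_le (mul_pos hc (norm_pos_iff.2 hx)) (hN x)
    have h1 := hscale (s := √n) (r := 2 ^ 19 * b) h hNx
      fun t ↦ hFb (t • (x : V)) (F.smul_mem t x.2)
    rw [div_mul_eq_mul_div, div_le_iff₀ (by positivity), mul_comm _ (2 ^ 19 * b)]
    exact h1
  obtain ⟨MF, hMF⟩ := IsDualPair.exists_of_le (N := N.comp F.subtype) (c := √n / (2 ^ 19 * b))
    (by positivity) hFN
  obtain ⟨G, hG, hGa⟩ := exists_submodule_polar_le (N.comp F.subtype) ha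
    ((integral_sq_comp_subtype_le N F).trans hNa)
  rw [← hn'] at hGa
  have hMFle := hMF.right_le (by positivity) hFN
  have hMF0 : ∀ z : F, z ≠ 0 → 0 < MF z := by
    intro z hz
    have h1 := hMF.inner_le z z
    rw [real_inner_self_eq_norm_sq] at h1
    have h2 : 0 < ‖z‖ ^ 2 := by have := norm_pos_iff.2 hz; positivity
    exact pos_of_mul_pos_right (h2.trans_le h1) (apply_nonneg _ _)
  have hGM : ∀ z : G, √n' / (2 ^ 19 * a) * ‖z‖ ≤ MF.comp G.subtype z := by
    intro z
    rcases eq_or_ne z 0 with rfl | hz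
    · simp
    have h1 := hscale (s := √n') (r := 2 ^ 19 * a) hMF.symm (hMF0 z (by simpa using hz))
      fun t ↦ hGa (t • (z : F)) (G.smul_mem t z.2)
    rw [div_mul_eq_mul_div, div_le_iff₀ (by positivity), mul_comm _ (2 ^ 19 * a)]
    exact h1
  obtain ⟨NG, hNG⟩ := IsDualPair.exists_of_le (N := MF.comp G.subtype) (c := √n' / (2 ^ 19 * a))
    (by positivity) hGM
  have hsub : IsSubquotient N NG :=
    (IsSubquotient.comp_subtype N F).trans (hMF.isSubquotient G hNG.symm)
  have hround : NG.IsRound (2 ^ 39 * (a * b) / n) := by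
    refine ⟨√n / (2 ^ 19 * b), by positivity, fun z ↦ ⟨?_, ?_⟩⟩
    · have h1 := hNG.le_right (C := (2 ^ 19 * b) / √n) (fun z ↦ by
        have h1 := hMFle z
        rw [div_mul_eq_mul_div, le_div_iff₀ hsn]
        rw [div_mul_eq_mul_div, div_le_iff₀ (by positivity)] at h1
        rw [mul_comm, mul_comm _ ‖z‖]
        exact h1) z
      rw [div_mul_eq_mul_div, div_le_iff₀ (by positivity)]
      rw [div_mul_eq_mul_div, le_div_iff₀ (by positivity)] at h1
      linarith
    · have h1 := hNG.right_le (by positivity) hGM z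
      rw [div_mul_eq_mul_div, div_le_iff₀ (by positivity)] at h1
      have h2 : √n / (2 ^ 19 * b) * (2 ^ 39 * (a * b) / n) = 2 ^ 20 * a / √n := by
        have : n = √n * √n := (Real.mul_self_sqrt hn0.le).symm
        rw [this, Real.sqrt_mul_self (Real.sqrt_nonneg _)]
        field_simp
      rw [h2, div_mul_eq_mul_div, le_div_iff₀ hsn]
      have h3 : √n ≤ 2 * √n' := by
        rw [Real.sqrt_le_left (by positivity), mul_pow, Real.sq_sqrt hn'0.le]
        linarith
      have h4 := mul_le_mul_of_nonneg_right h3 (apply_nonneg NG z)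
      linarith
  obtain ⟨N', hN', hr⟩ := hround.exists_euclidean
  exact ⟨_, N', by omega, hsub.trans hN', hr⟩

end QuotientOfSubspace

section Positions

open ProbabilityTheory
open scoped BigOperators RealInnerProductSpace

section Biorthogonal

variable {ι : Type*} [Fintype ι] [DecidableEq ι] {x y : ι → EuclideanSpace ℝ ι}

lemma inner_euclideanSum (hxy : ∀ i j, ⟪x i, y j⟫ = if i = j then 1 else 0)
    (u v : EuclideanSpace ℝ ι) : ⟪euclideanSum x u, euclideanSum y v⟫ = ⟪u, v⟫ := by
  simp_rw [euclideanSum_apply, sum_inner, inner_sum, real_inner_smul_left, real_inner_smul_right,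
    hxy, PiLp.inner_apply]
  refine Finset.sum_congr rfl fun i _ ↦ ?_
  simp [mul_comm]

lemma euclideanSum_injective (hxy : ∀ i j, ⟪x i, y j⟫ = if i = j then 1 else 0) :
    Function.Injective (euclideanSum x) := by
  refine (injective_iff_map_eq_zero _).2 fun u hu ↦ ?_
  have h := inner_euclideanSum hxy u u
  rw [hu, inner_zero_left, eq_comm, inner_self_eq_zero] at h
  exact h

/-- The linear equivalence with the given values on the standard basis of a Euclidean space, for a
member of a biorthogonal system. -/
noncomputable def euclideanSumEquiv (hxy : ∀ i j, ⟪x i, y j⟫ = if i = j then 1 else 0) :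
    EuclideanSpace ℝ ι ≃ₗ[ℝ] EuclideanSpace ℝ ι :=
  LinearEquiv.ofInjectiveEndo (euclideanSum x) (euclideanSum_injective hxy)

lemma coe_euclideanSumEquiv (hxy : ∀ i j, ⟪x i, y j⟫ = if i = j then 1 else 0) :
    (euclideanSumEquiv hxy).toLinearMap = euclideanSum x := by
  ext1 u
  rfl

lemma IsDualPair.comp_euclideanSum (hxy : ∀ i j, ⟪x i, y j⟫ = if i = j then 1 else 0)
    (hyx : ∀ i j, ⟪y i, x j⟫ = if i = j then 1 else 0)
    {N M : Seminorm ℝ (EuclideanSpace ℝ ι)} (h : IsDualPair N M) :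
    IsDualPair (N.comp (euclideanSum x)) (M.comp (euclideanSum y)) where
  inner_le u v := by
    rw [← inner_euclideanSum hxy]
    exact h.inner_le _ _
  exists_left v := by
    obtain ⟨z, hz, hzv⟩ := h.exists_left (euclideanSum y v)
    obtain ⟨u, rfl⟩ := (euclideanSumEquiv hxy).surjective z
    rw [← LinearEquiv.coe_coe, coe_euclideanSumEquiv] at hz hzv
    exact ⟨u, hz, by rw [← inner_euclideanSum hxy]; exact hzv⟩
  exists_right u := by
    obtain ⟨z, hz, hzv⟩ := h.exists_right (euclideanSum x u)
    obtain ⟨v, rfl⟩ := (euclideanSumEquiv hyx).surjective z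
    rw [← LinearEquiv.coe_coe, coe_euclideanSumEquiv] at hz hzv
    exact ⟨v, hz, by rw [← inner_euclideanSum hxy]; exact hzv⟩

end Biorthogonal

/-- Every norm is polynomially round after a linear change of coordinates. -/
lemma exists_isRound_sq {n : ℕ} (hn : 1 ≤ n) (N : Seminorm ℝ (EuclideanSpace ℝ (Fin n))) {c : ℝ}
    (hc : 0 < c) (hN : ∀ x, c * ‖x‖ ≤ N x) :
    ∃ N' : Seminorm ℝ (EuclideanSpace ℝ (Fin n)), IsSubquotient N N' ∧
      N'.IsRound ((n : ℝ) ^ 2) := by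
  obtain ⟨x, y, hxy, hx, hy⟩ := exists_lewis_position N hc hN
  have hn0 : (0 : ℝ) < n := by exact_mod_cast hn
  have hyx : ∀ i j, ⟪y i, x j⟫ = if i = j then (1 : ℝ) else 0 := fun i j ↦ by
    rw [real_inner_comm, hxy]; simp [eq_comm]
  refine ⟨_, IsSubquotient.comp_equiv N (euclideanSumEquiv hxy), (n : ℝ)⁻¹, by positivity,
    fun v ↦ ?_⟩
  rw [Seminorm.comp_apply, coe_euclideanSumEquiv]
  constructor
  · have h1 := hy fun i ↦ v i • euclideanSum x v
    have h2 : ∑ i, ⟪y i, v i • euclideanSum x v⟫ = ‖v‖ ^ 2 := by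
      rw [EuclideanSpace.real_norm_sq_eq]
      refine Finset.sum_congr rfl fun i _ ↦ ?_
      rw [real_inner_smul_right, euclideanSum_apply, inner_sum, sq]
      simp_rw [real_inner_smul_right, hyx]
      simp
    have h3 : radSq N (fun i ↦ v i • euclideanSum x v) = (‖v‖ * N (euclideanSum x v)) ^ 2 := by
      rw [mul_pow, EuclideanSpace.real_norm_sq_eq, radSq]
      have h4 := expect_norm_sq_signs fun i ↦ v i
      simp only [smul_eq_mul, Real.norm_eq_abs, sq_abs] at h4
      rw [← h4, Finset.expect_mul]
      refine Finset.expect_congr rfl fun ε _ ↦ ?_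
      simp_rw [smul_smul]
      rw [← Finset.sum_smul, map_smul_eq_mul, mul_pow, Real.norm_eq_abs, sq_abs]
    rw [h2, h3, Real.sqrt_sq (by positivity)] at h1
    rw [inv_mul_le_iff₀ hn0]
    rcases eq_or_ne v 0 with rfl | hv
    · simp
    · refine le_of_mul_le_mul_left ?_ (norm_pos_iff.2 hv)
      linarith
  · have h1 : ∀ i, N (x i) ≤ 1 := fun i ↦ by
      have := (sq_le_radSq N x i).trans hx
      have := apply_nonneg N (x i)
      nlinarith
    rw [sq, inv_mul_cancel_left₀ hn0.ne', euclideanSum_apply]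
    calc N (∑ i, v i • x i) ≤ ∑ i, N (v i • x i) :=
          Finset.le_sum_of_subadditive N (map_zero N).le (map_add_le_add N) _ _
      _ ≤ ∑ _i : Fin n, ‖v‖ := by
          refine Finset.sum_le_sum fun i _ ↦ ?_
          rw [map_smul_eq_mul]
          exact (mul_le_of_le_one_right (norm_nonneg _) (h1 i)).trans (PiLp.norm_apply_le v i)
      _ = n * ‖v‖ := by simp

/-- A round norm has a subquotient of proportional dimension which is exponentially rounder. -/
theorem Seminorm.IsRound.exists_polylog {n : ℕ} (hn : 1 ≤ n)
    {N : Seminorm ℝ (EuclideanSpace ℝ (Fin n))} {d : ℝ} (hd : 1 ≤ d) (hN : N.IsRound d) :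
    ∃ (k : ℕ) (N' : Seminorm ℝ (EuclideanSpace ℝ (Fin k))), n ≤ 4 * k ∧ IsSubquotient N N' ∧
      N'.IsRound (2 ^ 50 * (1 + Real.log d) ^ 3) := by
  wlog hc1 : ∀ x, 1 * ‖x‖ ≤ N x ∧ N x ≤ d * ‖x‖ generalizing N
  · obtain ⟨c, hc, hN⟩ := hN
    have h1 : ∀ x, 1 * ‖x‖ ≤ N.comp (LinearEquiv.smulOfNeZero ℝ (EuclideanSpace ℝ (Fin n)) c⁻¹
        (inv_ne_zero hc.ne')).toLinearMap x ∧ N.comp (LinearEquiv.smulOfNeZero ℝ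
        (EuclideanSpace ℝ (Fin n)) c⁻¹ (inv_ne_zero hc.ne')).toLinearMap x ≤ d * ‖x‖ := by
      intro x
      have h2 := hN x
      rw [Seminorm.comp_apply, LinearEquiv.coe_coe, LinearEquiv.smulOfNeZero_apply,
        map_smul_eq_mul, Real.norm_of_nonneg (by positivity), le_inv_mul_iff₀ hc,
        inv_mul_le_iff₀ hc, one_mul, ← mul_assoc]
      exact h2
    obtain ⟨k, N', hk, hNN', hr⟩ := this ⟨1, one_pos, by simpa only [one_mul] using h1⟩ h1
    exact ⟨k, N', hk, (IsSubquotient.comp_equiv N _).trans hNN', hr⟩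
  have hN1 : ∀ x, 1 * ‖x‖ ≤ N x := fun x ↦ (hc1 x).1
  have hNd : ∀ x, N x ≤ d * ‖x‖ := fun x ↦ (hc1 x).2
  have hn0 : (0 : ℝ) < n := by exact_mod_cast hn
  have hd0 : 0 < d := by linarith
  have hlog := Real.log_nonneg hd
  obtain ⟨L, hL⟩ : ∃ L, L = 1 + Real.log d := ⟨_, rfl⟩
  have hL1 : 1 ≤ L := by linarith
  obtain ⟨x, y, hxy, hx, hy⟩ := exists_lewis_position N one_pos hN1
  have hyx : ∀ i j, ⟪y i, x j⟫ = if i = j then (1 : ℝ) else 0 := fun i j ↦ by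
    rw [real_inner_comm, hxy]; simp [eq_comm]
  obtain ⟨M, hNM⟩ := IsDualPair.exists_of_le one_pos hN1
  obtain ⟨m, hm1, hdm, hmL⟩ : ∃ m : ℕ, 1 ≤ m ∧ d ^ 2 ≤ 4 ^ m ∧ (m : ℝ) ≤ 2 * L := by
    refine ⟨⌈Real.log d / Real.log 2⌉₊ + 1, by omega, ?_, ?_⟩
    · have h1 : Real.log d / Real.log 2 ≤ (⌈Real.log d / Real.log 2⌉₊ + 1 : ℕ) := by
        push_cast
        linarith [Nat.le_ceil (Real.log d / Real.log 2)]
      rw [div_le_iff₀ (Real.log_pos (by norm_num)), ← Real.log_pow,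
        Real.log_le_log_iff (by linarith) (by positivity)] at h1
      have h2 := pow_le_pow_left₀ (by linarith) h1 2
      refine h2.trans (le_of_eq ?_)
      rw [← pow_mul, mul_comm, pow_mul]
      norm_num
    · push_cast
      have h1 := Nat.ceil_lt_add_one (a := Real.log d / Real.log 2)
        (div_nonneg hlog (Real.log_nonneg (by norm_num)))
      have h2 : Real.log d / Real.log 2 ≤ 2 * Real.log d := by
        rw [div_le_iff₀ (Real.log_pos (by norm_num))]
        nlinarith [Real.log_two_gt_d9]
      rw [hL]
      linarith
  have hMy : radSq M y ≤ (n * (56 * L ^ 2)) ^ 2 := by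
    have h1 := sqrt_radSq_dual_le hNM (by simpa only [one_mul] using hN1) hNd hm1 hd hdm hn0.le hy
    rw [← Real.sqrt_le_left (by positivity)]
    refine h1.trans ?_
    have h2 : (m : ℝ) ^ 2 ≤ (2 * L) ^ 2 := by gcongr
    have h3 : 14 * (m : ℝ) ^ 2 ≤ 56 * L ^ 2 := by nlinarith
    gcongr
  have hMl : ∀ z, d⁻¹ * ‖z‖ ≤ M z := fun z ↦ by
    rw [inv_mul_le_iff₀ hd0]
    exact hNM.le_right hNd z
  have hMu : ∀ z, M z ≤ d⁻¹ * d * ‖z‖ := fun z ↦ by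
    rw [inv_mul_cancel₀ hd0.ne', one_mul]
    simpa using hNM.right_le one_pos hN1 z
  have hIN := integral_euclideanSum_le N one_pos hd hN1 (by simpa only [one_mul] using hNd) x
  have hIM := integral_euclideanSum_le M (inv_pos.2 hd0) hd hMl hMu y
  rw [← hL] at hIN hIM ⊢
  have hpair := hNM.comp_euclideanSum hxy hyx
  have hlow : ∃ c : ℝ, 0 < c ∧ ∀ v, c * ‖v‖ ≤ N.comp (euclideanSum x) v := by
    obtain ⟨C, hC, h⟩ := (M.comp (euclideanSum y)).exists_le_mul_norm
    refine ⟨C⁻¹, by positivity, fun v ↦ ?_⟩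
    rw [inv_mul_le_iff₀ hC]
    exact hpair.symm.le_right h v
  obtain ⟨c, hc, hlow⟩ := hlow
  obtain ⟨k, N', hk, hNN', hr⟩ := exists_isRound_of_isDualPair (a := √(32 * L))
    (b := √(32 * L) * (n * (56 * L ^ 2))) hpair (by simpa using Nat.lt_of_lt_of_le one_pos hn) hc hlow (by positivity)
    (by positivity)
    (by
      rw [Real.sq_sqrt (by positivity)]
      refine hIN.trans ?_
      exact mul_le_of_le_one_right (by positivity) hx)
    (by
      rw [mul_pow, Real.sq_sqrt (by positivity)]
      refine hIM.trans ?_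
      gcongr)
  rw [finrank_euclideanSpace_fin] at hk hr
  refine ⟨k, N', hk, ?_, hr.mono ?_⟩
  · rw [← coe_euclideanSumEquiv hxy] at hNN'
    exact (IsSubquotient.comp_equiv N _).trans hNN'
  · rw [← mul_assoc √(32 * L), Real.mul_self_sqrt (by positivity), div_le_iff₀ hn0]
    have : 0 ≤ L ^ 3 * n := by positivity
    nlinarith

end Positions

section Concentration

open ProbabilityTheory Real
open scoped RealInnerProductSpace

variable {V : Type*} [NormedAddCommGroup V] [InnerProductSpace ℝ V] [FiniteDimensional ℝ V]
  [MeasurableSpace V] [BorelSpace V]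

lemma Seminorm.integrable_exp_stdGaussian (N : Seminorm ℝ V) (a : ℝ) :
    Integrable (fun v ↦ exp (a * N v)) (stdGaussian V) := by
  obtain ⟨C, hC, hint⟩ := IsGaussian.exists_integrable_exp_sq (stdGaussian V)
  obtain ⟨b, hb, hN⟩ := N.exists_le_mul_norm
  refine (hint.const_mul (exp ((a * b) ^ 2 / (4 * C)))).mono'
    (by have := N.continuous_of_finiteDimensional'; fun_prop) (ae_of_all _ fun v ↦ ?_)
  rw [norm_of_nonneg (exp_nonneg _), ← exp_add]
  refine exp_le_exp.2 ?_
  have h1 : a * N v ≤ |a| * (b * ‖v‖) :=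
    mul_le_mul (le_abs_self a) (hN v) (apply_nonneg N v) (abs_nonneg a)
  have h2 : (a * b) ^ 2 / (4 * C) + C * ‖v‖ ^ 2 - |a| * (b * ‖v‖) =
      (|a| * b - 2 * C * ‖v‖) ^ 2 / (4 * C) := by
    field_simp
    rw [← sq_abs a]
    ring
  have h3 : 0 ≤ (|a| * b - 2 * C * ‖v‖) ^ 2 / (4 * C) := by positivity
  linarith

lemma Seminorm.integrable_stdGaussian (N : Seminorm ℝ V) : Integrable N (stdGaussian V) := by
  refine (N.integrable_exp_stdGaussian 1).mono'
    N.continuous_of_finiteDimensional'.aestronglyMeasurable (ae_of_all _ fun v ↦ ?_)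
  rw [norm_of_nonneg (apply_nonneg N v), one_mul]
  linarith [add_one_le_exp (N v)]

lemma integrable_exp_mul_sub_rotation (N : Seminorm ℝ V) {τ : ℝ} (hτ : 0 ≤ τ) (θ : ℝ) :
    Integrable (fun z : V × V ↦ exp (τ * (N z.1 - N (cos θ • z.1 + sin θ • z.2))))
      ((stdGaussian V).prod (stdGaussian V)) := by
  have hN := N.continuous_of_finiteDimensional'
  refine ((N.integrable_exp_stdGaussian τ).comp_fst (stdGaussian V)).mono'
    (by fun_prop) (ae_of_all _ fun z ↦ ?_)
  rw [norm_of_nonneg (exp_nonneg _)]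
  have := apply_nonneg N (cos θ • z.1 + sin θ • z.2)
  gcongr
  linarith

lemma integral_exp_mul_sub_rotation_le {N M : Seminorm ℝ V} (h : IsDualPair N M) {b : ℝ}
    (hN : ∀ x, N x ≤ b * ‖x‖) {τ : ℝ} (hτ : 0 ≤ τ) (θ : ℝ) :
    ∫ z : V × V, exp (τ * (N z.1 - N (cos θ • z.1 + sin θ • z.2)))
      ∂((stdGaussian V).prod (stdGaussian V)) ≤
    (∫ x, exp (τ * (1 - cos θ) * N x) ∂(stdGaussian V)) * exp ((τ * sin θ * b) ^ 2 / 2) := by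
  rw [integral_prod _ (integrable_exp_mul_sub_rotation N hτ θ), ← integral_mul_const]
  refine integral_mono_of_nonneg (ae_of_all _ fun x ↦ integral_nonneg fun y ↦ exp_nonneg _)
    ((N.integrable_exp_stdGaussian _).mul_const _) (ae_of_all _ fun x ↦ ?_)
  obtain ⟨p, hp, hxp⟩ := h.exists_right x
  have hpb : ‖p‖ ≤ |b| := by
    have h1 := h.le_right hN p
    have h2 := mul_le_mul (le_abs_self b) hp (apply_nonneg M p) (abs_nonneg b)
    linarith
  have hle : ∀ y, exp (τ * (N x - N (cos θ • x + sin θ • y))) ≤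
      exp (τ * (1 - cos θ) * N x) * exp ⟪-(τ * sin θ) • p, y⟫ := by
    intro y
    rw [← exp_add, real_inner_smul_left]
    refine exp_le_exp.2 ?_
    have h1 : ⟪cos θ • x + sin θ • y, p⟫ ≤ N (cos θ • x + sin θ • y) :=
      (h.inner_le _ p).trans (mul_le_of_le_one_right (apply_nonneg N _) hp)
    rw [inner_add_left, real_inner_smul_left, real_inner_smul_left, hxp, real_inner_comm p y] at h1
    nlinarith
  calc ∫ y, exp (τ * (N x - N (cos θ • x + sin θ • y))) ∂(stdGaussian V)
    _ ≤ ∫ y, exp (τ * (1 - cos θ) * N x) * exp ⟪-(τ * sin θ) • p, y⟫ ∂(stdGaussian V) :=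
      integral_mono_of_nonneg (ae_of_all _ fun y ↦ exp_nonneg _)
        ((integrable_exp_inner_stdGaussian _).const_mul _) (ae_of_all _ hle)
    _ ≤ exp (τ * (1 - cos θ) * N x) * exp ((τ * sin θ * b) ^ 2 / 2) := by
      rw [integral_const_mul, integral_exp_inner_stdGaussian, norm_smul, norm_neg,
        Real.norm_eq_abs, mul_pow, sq_abs, mul_pow _ b, ← sq_abs b]
      gcongr

/-- A discretized form of the Maurey–Pisier rotation argument. -/
lemma integral_exp_mul_integral_exp_neg_le {N M : Seminorm ℝ V} (h : IsDualPair N M) {b : ℝ}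
    (hN : ∀ x, N x ≤ b * ‖x‖) {a : ℝ} (ha : 0 ≤ a) :
    (∫ x, exp (a * N x) ∂(stdGaussian V)) * (∫ x, exp (-(a * N x)) ∂(stdGaussian V)) ≤
      2 * exp (2 * a ^ 2 * b ^ 2) := by
  have hNc := N.continuous_of_finiteDimensional'
  obtain ⟨L, hL⟩ := exists_nat_ge (max 1 (∫ x, exp (2 * a * N x) ∂(stdGaussian V)))
  have hL1 : (1 : ℝ) ≤ L := (le_max_left _ _).trans hL
  have hL2 := (le_max_right _ _).trans hL
  have hL0 : (0 : ℝ) < L := by linarith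
  obtain ⟨θ, hθ⟩ : ∃ θ : ℝ, θ = π / (2 * L) := ⟨_, rfl⟩
  have hθ0 : 0 ≤ θ := by rw [hθ]; positivity
  have hπ : π ≤ 4 := pi_le_four
  have hLθ : L * θ = π / 2 := by rw [hθ]; field_simp
  have hτ : 0 ≤ a * L := by positivity
  obtain ⟨F, hF⟩ : ∃ F : V × V → ℝ,
    F = fun z ↦ exp (a * L * (N z.1 - N (cos θ • z.1 + sin θ • z.2))) := ⟨_, rfl⟩
  have hFi : Integrable F ((stdGaussian V).prod (stdGaussian V)) := by
    rw [hF]; exact integrable_exp_mul_sub_rotation N hτ θ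
  have hFJ : ∫ z, F z ∂((stdGaussian V).prod (stdGaussian V)) ≤ 2 * exp (2 * a ^ 2 * b ^ 2) := by
    rw [hF]
    refine (integral_exp_mul_sub_rotation_le h hN hτ θ).trans ?_
    refine mul_le_mul ?_ ?_ (exp_nonneg _) zero_le_two
    · have hle : ∀ x, exp (a * L * (1 - cos θ) * N x) ≤ 1 + 1 / L * exp (2 * a * N x) := by
        intro x
        have h1 : a * L * (1 - cos θ) * N x ≤ 1 / L * (2 * a * N x) := by
          have h2 : L * (1 - cos θ) ≤ 1 / L * 2 := by
            rw [one_div, ← div_eq_inv_mul, le_div_iff₀ hL0]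
            have h3 : L * L * (1 - cos θ) ≤ L * L * (θ ^ 2 / 2) := by
              gcongr
              linarith [one_sub_sq_div_two_le_cos (x := θ)]
            have h4 : L * L * (θ ^ 2 / 2) = (π / 2) ^ 2 / 2 := by rw [← hLθ]; ring
            nlinarith [pi_pos]
          have h5 := mul_le_mul_of_nonneg_right h2 (mul_nonneg ha (apply_nonneg N x))
          linarith
        refine (exp_le_exp.2 h1).trans ?_
        have h6 := convexOn_exp.2 (Set.mem_univ (2 * a * N x)) (Set.mem_univ 0)
          (show 0 ≤ 1 / (L : ℝ) by positivity)
          (show 0 ≤ 1 - 1 / (L : ℝ) by rw [sub_nonneg, div_le_one hL0]; exact hL1) (by ring)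
        simp only [smul_eq_mul, mul_zero, add_zero, exp_zero, mul_one] at h6
        have : (0 : ℝ) < 1 / L := by positivity
        linarith
      have hi := (N.integrable_exp_stdGaussian (2 * a)).const_mul (1 / (L : ℝ))
      calc ∫ x, exp (a * L * (1 - cos θ) * N x) ∂(stdGaussian V)
        _ ≤ ∫ x, (1 + 1 / L * exp (2 * a * N x)) ∂(stdGaussian V) :=
          integral_mono_of_nonneg (ae_of_all _ fun x ↦ exp_nonneg _)
            ((integrable_const _).add hi) (ae_of_all _ hle)
        _ = 1 + 1 / L * ∫ x, exp (2 * a * N x) ∂(stdGaussian V) := by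
          rw [integral_add (integrable_const _) hi, integral_const_mul]
          simp
        _ ≤ 1 + 1 / L * L := by gcongr
        _ = 2 := by field_simp; norm_num
    · refine exp_le_exp.2 ?_
      have h1 : L * sin θ ≤ 2 := by
        have := mul_le_mul_of_nonneg_left (sin_le hθ0) hL0.le
        linarith
      have h2 : 0 ≤ L * sin θ := mul_nonneg hL0.le (sin_nonneg_of_nonneg_of_le_pi hθ0 (by
        have := mul_le_mul_of_nonneg_right hL1 hθ0
        linarith [pi_pos]))
      have h3 : (L * sin θ) ^ 2 ≤ 4 := by nlinarith
      nlinarith [mul_le_mul_of_nonneg_right h3 (sq_nonneg (a * b))]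
  obtain ⟨R, hR⟩ : ∃ R : ℕ → V × V →L[ℝ] V × V,
    R = fun k : ℕ ↦ ContinuousLinearMap.rotation (k * θ) := ⟨_, rfl⟩
  have hRmap : ∀ k, ((stdGaussian V).prod (stdGaussian V)).map (R k) =
      (stdGaussian V).prod (stdGaussian V) := fun k ↦ by
    rw [hR]
    exact IsGaussian.map_rotation_eq_self integral_id_stdGaussian _
  have hRi : ∀ k, Integrable (fun z ↦ F (R k z)) ((stdGaussian V).prod (stdGaussian V)) := by
    intro k
    have h1 : Integrable F (((stdGaussian V).prod (stdGaussian V)).map (R k)) := by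
      rwa [hRmap]
    exact h1.comp_measurable (R k).continuous.measurable
  have hRJ : ∀ k, ∫ z, F (R k z) ∂((stdGaussian V).prod (stdGaussian V)) =
      ∫ z, F z ∂((stdGaussian V).prod (stdGaussian V)) := by
    intro k
    conv_rhs => rw [← hRmap k]
    rw [integral_map (R k).continuous.aemeasurable (by rw [hRmap]; exact hFi.1)]
  have hle : ∀ z : V × V, exp (a * N z.1) * exp (-(a * N z.2)) ≤
      ∑ k ∈ Finset.range L, 1 / (L : ℝ) * F (R k z) := by
    intro z
    obtain ⟨u, hu⟩ : ∃ u : ℕ → ℝ, u = fun k : ℕ ↦ N (R k z).1 := ⟨_, rfl⟩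
    have hFu : ∀ k, F (R k z) = exp (a * L * (u k - u (k + 1))) := by
      intro k
      rw [hF, hu, hR]
      simp only [ContinuousLinearMap.rotation_apply]
      congr 4
      push_cast
      rw [add_mul, one_mul, cos_add, sin_add]
      module
    have h0 : u 0 = N z.1 := by simp [hu, hR, ContinuousLinearMap.rotation_apply]
    have h1 : u L = N z.2 := by
      simp [hu, hR, ContinuousLinearMap.rotation_apply, hLθ]
    have h2 := convexOn_exp.map_sum_le (t := Finset.range L) (w := fun _ ↦ 1 / (L : ℝ))
      (p := fun k ↦ a * L * (u k - u (k + 1))) (fun _ _ ↦ by positivity)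
      (by simp [hL0.ne']) (fun _ _ ↦ Set.mem_univ _)
    have h3 : ∑ k ∈ Finset.range L, (1 / (L : ℝ)) • (a * L * (u k - u (k + 1))) =
        a * (N z.1 - N z.2) := by
      rw [← h0, ← h1, ← Finset.sum_range_sub' u L, Finset.mul_sum]
      refine Finset.sum_congr rfl fun k _ ↦ ?_
      rw [smul_eq_mul]
      field_simp
    rw [h3] at h2
    rw [← exp_add, ← sub_eq_add_neg, ← mul_sub]
    simpa only [hFu, smul_eq_mul] using h2
  rw [← integral_prod_mul]
  calc ∫ z : V × V, exp (a * N z.1) * exp (-(a * N z.2)) ∂((stdGaussian V).prod (stdGaussian V))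
    _ ≤ ∫ z, ∑ k ∈ Finset.range L, 1 / (L : ℝ) * F (R k z)
        ∂((stdGaussian V).prod (stdGaussian V)) :=
      integral_mono_of_nonneg (ae_of_all _ fun z ↦ by positivity)
        (integrable_finsetSum _ fun k _ ↦ (hRi k).const_mul _) (ae_of_all _ hle)
    _ = ∫ z, F z ∂((stdGaussian V).prod (stdGaussian V)) := by
      rw [integral_finsetSum _ fun k _ ↦ (hRi k).const_mul _]
      simp_rw [integral_const_mul, hRJ]
      rw [Finset.sum_const, Finset.card_range, nsmul_eq_mul]
      field_simp
    _ ≤ 2 * exp (2 * a ^ 2 * b ^ 2) := hFJ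

end Concentration

section Dvoretzky

open ProbabilityTheory Real
open scoped RealInnerProductSpace

variable {V : Type*} [NormedAddCommGroup V] [InnerProductSpace ℝ V] [FiniteDimensional ℝ V]
  [MeasurableSpace V] [BorelSpace V]

lemma integral_exp_mul_sub_mean_le {N M : Seminorm ℝ V} (h : IsDualPair N M) {b : ℝ}
    (hN : ∀ x, N x ≤ b * ‖x‖) (a : ℝ) :
    ∫ x, exp (a * (N x - ∫ y, N y ∂(stdGaussian V))) ∂(stdGaussian V) ≤
      2 * exp (2 * a ^ 2 * b ^ 2) := by
  obtain ⟨m, hm⟩ : ∃ m, m = ∫ y, N y ∂(stdGaussian V) := ⟨_, rfl⟩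
  rw [← hm]
  have hsplit : ∀ s : ℝ, ∫ x, exp (s * (N x - m)) ∂(stdGaussian V) =
      exp (-(s * m)) * ∫ x, exp (s * N x) ∂(stdGaussian V) := by
    intro s
    rw [← integral_const_mul]
    congr 1 with x
    rw [← exp_add]
    ring_nf
  have hone : ∀ s : ℝ, 1 ≤ ∫ x, exp (s * (N x - m)) ∂(stdGaussian V) := by
    intro s
    have hi1 : Integrable (fun x ↦ N x - m) (stdGaussian V) :=
      N.integrable_stdGaussian.sub (integrable_const m)
    have hi : Integrable (fun x ↦ s * (N x - m) + 1) (stdGaussian V) :=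
      (hi1.const_mul s).add (integrable_const 1)
    have hi2 : Integrable (fun x ↦ exp (s * (N x - m))) (stdGaussian V) := by
      have := (N.integrable_exp_stdGaussian s).const_mul (exp (-(s * m)))
      refine this.congr (ae_of_all _ fun x ↦ ?_)
      dsimp only
      rw [← exp_add]
      ring_nf
    calc (1 : ℝ) = ∫ x, (s * (N x - m) + 1) ∂(stdGaussian V) := by
          rw [integral_add (hi1.const_mul s) (integrable_const 1), integral_const_mul, integral_sub N.integrable_stdGaussian
            (integrable_const m), ← hm]
          simp
      _ ≤ _ := integral_mono hi hi2 fun x ↦ add_one_le_exp _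
  have hprod : ∀ s : ℝ, (∫ x, exp (s * (N x - m)) ∂(stdGaussian V)) *
      (∫ x, exp (-s * (N x - m)) ∂(stdGaussian V)) =
      (∫ x, exp (s * N x) ∂(stdGaussian V)) * (∫ x, exp (-(s * N x)) ∂(stdGaussian V)) := by
    intro s
    rw [hsplit, hsplit, mul_mul_mul_comm, ← exp_add]
    simp
  have hfin : ∀ s : ℝ, 0 ≤ s → (∫ x, exp (s * (N x - m)) ∂(stdGaussian V)) *
      (∫ x, exp (-s * (N x - m)) ∂(stdGaussian V)) ≤ 2 * exp (2 * s ^ 2 * b ^ 2) := by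
    intro s hs
    rw [hprod]
    exact integral_exp_mul_integral_exp_neg_le h hN hs
  rcases le_total 0 a with ha | ha
  · exact (le_mul_of_one_le_right (by linarith [hone a]) (hone (-a))).trans (hfin a ha)
  · have := hfin (-a) (by linarith)
    rw [neg_neg, neg_sq] at this
    exact (le_mul_of_one_le_left (by linarith [hone a]) (hone (-a))).trans this

/-- Gaussian concentration for norms. -/
lemma measureReal_le_abs_sub_mean_le {N M : Seminorm ℝ V} (h : IsDualPair N M) {b : ℝ}
    (hb : 0 < b) (hN : ∀ x, N x ≤ b * ‖x‖) {t : ℝ} (ht : 0 ≤ t) :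
    (stdGaussian V).real {v | t ≤ |N v - ∫ y, N y ∂(stdGaussian V)|} ≤
      4 * exp (-t ^ 2 / (8 * b ^ 2)) := by
  obtain ⟨m, hm⟩ : ∃ m, m = ∫ y, N y ∂(stdGaussian V) := ⟨_, rfl⟩
  have hmarkov : ∀ s : ℝ, |s| = t / (4 * b ^ 2) →
      (stdGaussian V).real {v | |s| * t ≤ s * (N v - m)} ≤ 2 * exp (-t ^ 2 / (8 * b ^ 2)) := by
    intro s hs
    have hi2 : Integrable (fun x ↦ exp (s * (N x - m))) (stdGaussian V) := by
      have := (N.integrable_exp_stdGaussian s).const_mul (exp (-(s * m)))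
      refine this.congr (ae_of_all _ fun x ↦ ?_)
      dsimp only
      rw [← exp_add]
      ring_nf
    have h1 := mul_meas_ge_le_integral_of_nonneg (ae_of_all _ fun x ↦ exp_nonneg _) hi2
      (exp (|s| * t))
    simp_rw [exp_le_exp] at h1
    have h2 := h1.trans (hm ▸ integral_exp_mul_sub_mean_le h hN s)
    rw [← le_div_iff₀' (exp_pos _)] at h2
    refine h2.trans (le_of_eq ?_)
    rw [mul_div_assoc, ← exp_sub, ← sq_abs s, hs]
    congr 2
    field_simp
    ring
  rw [← hm]
  have hs0 : 0 ≤ t / (4 * b ^ 2) := by positivity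
  have h1 := hmarkov (t / (4 * b ^ 2)) (abs_of_nonneg hs0)
  have h2 := hmarkov (-(t / (4 * b ^ 2))) (by rw [abs_neg, abs_of_nonneg hs0])
  have hsub : {v | t ≤ |N v - m|} ⊆
      {v | |t / (4 * b ^ 2)| * t ≤ t / (4 * b ^ 2) * (N v - m)} ∪
      {v | |-(t / (4 * b ^ 2))| * t ≤ -(t / (4 * b ^ 2)) * (N v - m)} := by
    intro v hv
    rw [Set.mem_ofPred_eq] at hv
    rw [Set.mem_union, Set.mem_ofPred_eq, Set.mem_ofPred_eq, abs_neg, abs_of_nonneg hs0]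
    rcases le_abs.1 hv with h | h
    · exact Or.inl (mul_le_mul_of_nonneg_left h hs0)
    · right
      have := mul_le_mul_of_nonneg_left h hs0
      linarith
  have h3 := measureReal_mono hsub (μ := stdGaussian V)
  have h4 := measureReal_union_le (μ := stdGaussian V)
    {v | |t / (4 * b ^ 2)| * t ≤ t / (4 * b ^ 2) * (N v - m)}
    {v | |-(t / (4 * b ^ 2))| * t ≤ -(t / (4 * b ^ 2)) * (N v - m)}
  linarith

lemma sqrt_finrank_div_four_le_integral_norm :
    √(Module.finrank ℝ V) / 4 ≤ ∫ v, ‖v‖ ∂(stdGaussian V) := by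
  obtain ⟨n, hn⟩ : ∃ n, n = Module.finrank ℝ V := ⟨_, rfl⟩
  rw [← hn]
  rcases Nat.eq_zero_or_pos n with h0 | h0
  · rw [h0]
    simpa using integral_nonneg fun v : V ↦ norm_nonneg v
  have hn0 : (0 : ℝ) < n := by exact_mod_cast h0
  have hi : Integrable (fun v : V ↦ ‖v‖) (stdGaussian V) := (normSeminorm ℝ V).integrable_stdGaussian
  obtain ⟨e, he⟩ : ∃ e, e = stdOrthonormalBasis ℝ V := ⟨_, rfl⟩
  have habs : ∀ i, 1 / 4 ≤ ∫ v, |⟪e i, v⟫| ∂(stdGaussian V) := by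
    intro i
    have hii : Integrable (fun v ↦ |⟪e i, v⟫|) (stdGaussian V) := by
      refine hi.mono' (by fun_prop) (ae_of_all _ fun v ↦ ?_)
      rw [Real.norm_eq_abs, abs_abs]
      simpa using abs_real_inner_le_norm (e i) v
    have hexp := integral_exp_mul_inner_sq_stdGaussian (e.orthonormal.1 i)
      (show (-1 / 2 : ℝ) < 1 / 2 by norm_num)
    have hie : Integrable (fun v ↦ exp (-1 / 2 * ⟪e i, v⟫ ^ 2)) (stdGaussian V) := by
      by_contra hcon
      rw [integral_undef hcon] at hexp
      norm_num at hexp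
      exact (sqrt_pos.2 two_pos).ne hexp
    have hle : ∀ v, 1 - exp (-1 / 2 * ⟪e i, v⟫ ^ 2) ≤ |⟪e i, v⟫| := by
      intro v
      generalize ⟪e i, v⟫ = x
      have h1 := add_one_le_exp (-1 / 2 * x ^ 2)
      have h2 := exp_pos (-1 / 2 * x ^ 2)
      rw [← sq_abs] at h1 h2 ⊢
      rcases le_total |x| 2 with hx | hx
      · nlinarith [abs_nonneg x]
      · linarith
    have h3 := integral_mono ((integrable_const 1).sub hie) hii hle
    simp only [Pi.sub_apply] at h3
    rw [integral_sub (integrable_const 1) hie, hexp] at h3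
    have h4 : (√(1 - 2 * (-1 / 2)))⁻¹ ≤ 3 / 4 := by
      rw [inv_le_comm₀ (by positivity) (by norm_num)]
      apply le_sqrt_of_sq_le
      norm_num
    simp only [integral_const, probReal_univ, smul_eq_mul, mul_one] at h3
    linarith
  have hsum : ∀ v : V, ∑ i, |⟪e i, v⟫| ≤ √n * ‖v‖ := by
    intro v
    refine abs_le_of_sq_le_sq' ?_ (by positivity) |>.2
    have h1 := sq_sum_le_card_mul_sum_sq (s := Finset.univ) (f := fun i ↦ |⟪e i, v⟫|)
    simp_rw [sq_abs, Finset.card_univ, Fintype.card_fin, ← hn] at h1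
    rw [e.sum_sq_inner_right] at h1
    rwa [mul_pow, sq_sqrt hn0.le]
  have h5 : ∫ v, ∑ i, |⟪e i, v⟫| ∂(stdGaussian V) ≤ ∫ v, √n * ‖v‖ ∂(stdGaussian V) :=
    integral_mono_of_nonneg (ae_of_all _ fun v ↦ Finset.sum_nonneg fun i _ ↦ abs_nonneg _)
      (hi.const_mul _) (ae_of_all _ hsum)
  rw [integral_const_mul, integral_finsetSum _ fun i _ ↦ by
      refine hi.mono' (by fun_prop) (ae_of_all _ fun v ↦ ?_)
      rw [Real.norm_eq_abs, abs_abs]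
      simpa using abs_real_inner_le_norm (e i) v] at h5
  have h6 := Finset.sum_le_sum fun i (_ : i ∈ Finset.univ) ↦ habs i
  have hn' : (Module.finrank ℝ V : ℝ) = n := by rw [hn]
  rw [Finset.sum_const, Finset.card_univ, Fintype.card_fin, nsmul_eq_mul, hn'] at h6
  have h7 : 0 < √(n : ℝ) := sqrt_pos.2 hn0
  refine le_of_mul_le_mul_left ?_ h7
  nlinarith [mul_self_sqrt hn0.le]

lemma map_euclideanSum_pi_stdGaussian {ι : Type*} [Fintype ι] {x : EuclideanSpace ℝ ι}
    (hx : ‖x‖ = 1) :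
    (Measure.pi fun _ : ι ↦ stdGaussian V).map (fun ω ↦ euclideanSum ω x) = stdGaussian V := by
  have hm : Measurable (fun ω : ι → V ↦ euclideanSum ω x) := by
    simp_rw [euclideanSum_apply]
    fun_prop
  have := Measure.isProbabilityMeasure_map (μ := Measure.pi fun _ : ι ↦ stdGaussian V)
    hm.aemeasurable
  apply Measure.ext_of_charFun
  ext t
  rw [charFun_apply, integral_map hm.aemeasurable
    (Measurable.aestronglyMeasurable (by fun_prop))]
  have h1 : ∀ ω : ι → V, Complex.exp (⟪euclideanSum ω x, t⟫ * Complex.I) =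
      ∏ i, Complex.exp (⟪ω i, x i • t⟫ * Complex.I) := by
    intro ω
    rw [← Complex.exp_sum, euclideanSum_apply, sum_inner, ← Finset.sum_mul]
    push_cast
    congr 2
    refine Finset.sum_congr rfl fun i _ ↦ ?_
    rw [real_inner_smul_left, real_inner_smul_right]
  simp_rw [h1]
  rw [integral_fintype_prod_eq_prod (fun i v ↦ Complex.exp (⟪v, x i • t⟫ * Complex.I))]
  simp_rw [← charFun_apply, charFun_stdGaussian, ← Complex.exp_sum]
  congr 1
  have h2 : ∑ i, x i ^ 2 = 1 := by
    rw [← EuclideanSpace.real_norm_sq_eq, hx, one_pow]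
  have h3 : ∑ i, (-‖x i • t‖ ^ 2 / 2) = -‖t‖ ^ 2 / 2 := by
    calc ∑ i, (-‖x i • t‖ ^ 2 / 2) = ∑ i, x i ^ 2 * (-‖t‖ ^ 2 / 2) := by
          refine Finset.sum_congr rfl fun i _ ↦ ?_
          rw [norm_smul, mul_pow, Real.norm_eq_abs, sq_abs]
          ring
      _ = _ := by rw [← Finset.sum_mul, h2, one_mul]
  exact_mod_cast h3

end Dvoretzky

section RoundSubquotients

open ProbabilityTheory Real

lemma Seminorm.bounds_of_net {E : Type*} [NormedAddCommGroup E] [InnerProductSpace ℝ E]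
    [FiniteDimensional ℝ E] (P : Seminorm ℝ E) {S : Finset E} {m : ℝ}
    (hnet : ∀ x, ‖x‖ = 1 → ∃ y ∈ S, ‖x - y‖ ≤ 1 / 4) (hS : ∀ y ∈ S, |P y - m| ≤ m / 4) (x : E) :
    m / 3 * ‖x‖ ≤ P x ∧ P x ≤ m / 3 * 5 * ‖x‖ := by
  have hsphere : ∀ x, ‖x‖ = 1 → m / 3 ≤ P x ∧ P x ≤ m / 3 * 5 := by
    intro x hx
    obtain ⟨z, hz, hmax⟩ := (isCompact_sphere (0 : E) 1).exists_isMaxOn ⟨x, by simpa using hx⟩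
      P.continuous_of_finiteDimensional'.continuousOn
    have hle : ∀ w, P w ≤ P z * ‖w‖ := by
      intro w
      rcases eq_or_ne w 0 with rfl | hw
      · simp
      have hw' := norm_pos_iff.2 hw
      have h1 := hmax (show ‖w‖⁻¹ • w ∈ Metric.sphere (0 : E) 1 by
        simp [norm_smul, hw'.ne'])
      simp only [Set.mem_ofPred_eq, map_smul_eq_mul, norm_inv, norm_norm] at h1
      rwa [inv_mul_le_iff₀ hw', mul_comm] at h1
    have hA : P z ≤ m / 3 * 5 := by
      obtain ⟨y, hy, hzy⟩ := hnet z (by simpa using hz)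
      have h1 := (abs_le.1 (hS y hy)).2
      have h2 := map_add_le_add P y (z - y)
      rw [add_sub_cancel] at h2
      have h3 := hle (z - y)
      have h4 := mul_le_mul_of_nonneg_left hzy (apply_nonneg P z)
      linarith
    obtain ⟨y, hy, hxy⟩ := hnet x hx
    have h1 := (abs_le.1 (hS y hy)).1
    have h2 := map_add_le_add P x (y - x)
    rw [add_sub_cancel] at h2
    have h3 := hle (y - x)
    rw [norm_sub_rev] at hxy
    have h4 := mul_le_mul_of_nonneg_left hxy (apply_nonneg P z)
    have h5 := hle x
    rw [hx, mul_one] at h5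
    exact ⟨by linarith, by linarith⟩
  rcases eq_or_ne x 0 with rfl | hx
  · simp
  have hx' := norm_pos_iff.2 hx
  have h1 := hsphere (‖x‖⁻¹ • x) (by simp [norm_smul, hx'.ne'])
  rw [map_smul_eq_mul, norm_inv, norm_norm, ← div_eq_inv_mul] at h1
  exact ⟨(le_div_iff₀ hx').1 h1.1, (div_le_iff₀ hx').1 h1.2⟩

lemma IsSubquotient.comp_of_injective {V V' : Type*} [AddCommGroup V] [Module ℝ V]
    [AddCommGroup V'] [Module ℝ V'] (N : Seminorm ℝ V) {T : V' →ₗ[ℝ] V}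
    (hT : Function.Injective T) : IsSubquotient N (N.comp T) :=
  (IsSubquotient.comp_subtype N (LinearMap.range T)).trans
    (IsSubquotient.comp_equiv _ (LinearEquiv.ofInjective T hT))

lemma IsSubquotient.comp_of_le {V V' : Type*} [AddCommGroup V] [Module ℝ V]
    [NormedAddCommGroup V'] [Module ℝ V'] (N : Seminorm ℝ V) {T : V' →ₗ[ℝ] V} {c : ℝ} (hc : 0 < c)
    (hT : ∀ x, c * ‖x‖ ≤ N (T x)) : IsSubquotient N (N.comp T) := by
  refine IsSubquotient.comp_of_injective N ((injective_iff_map_eq_zero T).2 fun x hx ↦ ?_)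
  have := hT x
  rw [hx, map_zero] at this
  exact norm_le_zero_iff.1 (nonpos_of_mul_nonpos_right this hc)

lemma Seminorm.IsRound.exists_isRound_one {V : Type*} [NormedAddCommGroup V]
    [InnerProductSpace ℝ V] {N : Seminorm ℝ V} {d : ℝ} (hN : N.IsRound d)
    [Nontrivial V] : ∃ N' : Seminorm ℝ (EuclideanSpace ℝ (Fin 1)),
      IsSubquotient N N' ∧ N'.IsRound 1 := by
  obtain ⟨c, hc, hN⟩ := hN
  obtain ⟨v, hv⟩ := exists_ne (0 : V)
  have hNv : 0 < N v := (mul_pos hc (norm_pos_iff.2 hv)).trans_le (hN v).1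
  have h1 : ∀ x, N (euclideanSum (fun _ : Fin 1 ↦ v) x) = N v * ‖x‖ := by
    intro x
    rw [euclideanSum_apply, EuclideanSpace.norm_eq]
    simp [map_smul_eq_mul, mul_comm, sqrt_sq_eq_abs]
  refine ⟨_, IsSubquotient.comp_of_le N hNv fun x ↦ (h1 x).ge, N v, hNv, fun x ↦ ?_⟩
  rw [Seminorm.comp_apply, h1, mul_one]
  exact ⟨le_rfl, le_rfl⟩

variable {V : Type*} [NormedAddCommGroup V] [InnerProductSpace ℝ V] [FiniteDimensional ℝ V]

/-- Dvoretzky's theorem, in Milman's form. -/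
lemma Seminorm.IsRound.exists_isRound_five {N : Seminorm ℝ V} {d : ℝ} (hd : 1 ≤ d)
    (hN : N.IsRound d) {k : ℕ} (hk : 1 ≤ k) (hkd : 2 ^ 19 * d ^ 2 * k ≤ Module.finrank ℝ V) :
    ∃ N' : Seminorm ℝ (EuclideanSpace ℝ (Fin k)), IsSubquotient N N' ∧ N'.IsRound 5 := by
  let _ : MeasurableSpace V := borel V
  have : BorelSpace V := ⟨rfl⟩
  obtain ⟨c, hc, hN⟩ := hN
  obtain ⟨M, hM⟩ := IsDualPair.exists_of_le hc fun x ↦ (hN x).1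
  have hk1 : (1 : ℝ) ≤ k := by exact_mod_cast hk
  have hcd : 0 < c * d := by positivity
  obtain ⟨n, hn⟩ : ∃ n, n = Module.finrank ℝ V := ⟨_, rfl⟩
  rw [← hn] at hkd
  obtain ⟨m, hm⟩ : ∃ m, m = ∫ v, N v ∂(stdGaussian V) := ⟨_, rfl⟩
  have hmn : c * √n / 4 ≤ m := by
    have h1 := sqrt_finrank_div_four_le_integral_norm (V := V)
    have h2 : ∫ v, c * ‖v‖ ∂(stdGaussian V) ≤ ∫ v, N v ∂(stdGaussian V) :=
      integral_mono ((normSeminorm ℝ V).integrable_stdGaussian.const_mul c)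
        N.integrable_stdGaussian fun v ↦ (hN v).1
    rw [integral_const_mul, ← hm] at h2
    rw [← hn] at h1
    have := mul_le_mul_of_nonneg_left h1 hc.le
    linarith
  have hn0 : (0 : ℝ) < n := lt_of_lt_of_le (by positivity) hkd
  have hm0 : 0 < m := lt_of_lt_of_le (by have := sqrt_pos.2 hn0; positivity) hmn
  have hexponent : 256 * (k : ℝ) ≤ (m / 4) ^ 2 / (8 * (c * d) ^ 2) := by
    rw [le_div_iff₀ (by positivity)]
    have h1 := pow_le_pow_left₀ (by positivity) hmn 2
    rw [div_pow, mul_pow, sq_sqrt hn0.le] at h1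
    have h2 := mul_le_mul_of_nonneg_left hkd (sq_nonneg c)
    nlinarith
  obtain ⟨S, hS1, hScard, hS⟩ := exists_norm_net (r := 1) (s := 1 / 4) (by norm_num)
    (Metric.sphere (0 : EuclideanSpace ℝ (Fin k)) 1) (fun x hx ↦ by simp at hx; exact hx.le)
  rw [finrank_euclideanSpace_fin] at hScard
  obtain ⟨ω, hω⟩ : ∃ ω : Fin k → V, ∀ x ∈ S, |N (euclideanSum ω x) - m| ≤ m / 4 := by
    by_contra! hcon
    have hP : ∀ x ∈ S, (Measure.pi fun _ : Fin k ↦ stdGaussian V).real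
        {ω | m / 4 ≤ |N (euclideanSum ω x) - m|} ≤ 4 * exp (-(256 * k)) := by
      intro x hx
      have h1 := measureReal_le_abs_sub_mean_le hM hcd (fun x ↦ (hN x).2)
        (t := m / 4) (by positivity)
      have hmeas : MeasurableSet {v | m / 4 ≤ |N v - m|} := by
        have := N.continuous_of_finiteDimensional'
        exact (isClosed_le (by fun_prop) (by fun_prop)).measurableSet
      rw [← hm] at h1
      conv_lhs at h1 => rw [← map_euclideanSum_pi_stdGaussian (V := V)
        (show ‖x‖ = 1 by simpa using hS1 x hx)]
      rw [map_measureReal_apply (by simp_rw [euclideanSum_apply]; fun_prop) hmeas] at h1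
      refine h1.trans ?_
      gcongr
      rw [neg_div]
      linarith
    have h1 : (Set.univ : Set (Fin k → V)) ⊆
        ⋃ x ∈ S, {ω | m / 4 ≤ |N (euclideanSum ω x) - m|} := by
      intro ω _
      obtain ⟨x, hx, h⟩ := hcon ω
      simp only [Set.mem_iUnion]
      exact ⟨x, hx, h.le⟩
    have h2 := measureReal_mono h1
      (measure_ne_top (Measure.pi fun _ : Fin k ↦ stdGaussian V) _)
    rw [probReal_univ] at h2
    have h3 := h2.trans ((measureReal_biUnion_finset_le _ _).trans (Finset.sum_le_sum hP))
    rw [Finset.sum_const, nsmul_eq_mul] at h3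
    have h4 : (S.card : ℝ) * (4 * exp (-(256 * k))) ≤ 8 * exp (-128) := by
      calc (S.card : ℝ) * (4 * exp (-(256 * k)))
        _ ≤ 2 * exp (8 * 1 ^ 2 * k / (1 / 4) ^ 2) * (4 * exp (-(256 * k))) := by gcongr
        _ = 8 * exp (-(128 * k)) := by
          rw [mul_mul_mul_comm, ← exp_add]
          ring_nf
        _ ≤ 8 * exp (-128) := by gcongr; linarith
    have h5 := h3.trans h4
    rw [exp_neg, ← div_eq_mul_inv, le_div_iff₀ (exp_pos _)] at h5
    linarith [add_one_le_exp (128 : ℝ)]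
  have hb := (N.comp (euclideanSum ω)).bounds_of_net (fun x hx ↦ hS x (by simpa using hx)) hω
  exact ⟨_, IsSubquotient.comp_of_le N (by positivity) fun x ↦ (hb x).1, m / 3, by positivity, hb⟩

lemma Seminorm.IsRound.exists_isRound_five_of_finrank_pos {N : Seminorm ℝ V} {d : ℝ} (hd : 1 ≤ d)
    (hN : N.IsRound d) (hV : 0 < Module.finrank ℝ V) :
    ∃ (k : ℕ) (N' : Seminorm ℝ (EuclideanSpace ℝ (Fin k))),
      Module.finrank ℝ V ≤ 2 ^ 20 * d ^ 2 * k ∧ IsSubquotient N N' ∧ N'.IsRound 5 := by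
  have hV' : (0 : ℝ) < Module.finrank ℝ V := by exact_mod_cast hV
  rcases le_or_gt (2 ^ 19 * d ^ 2) (Module.finrank ℝ V : ℝ) with h | h
  · have hd0 : 0 < 2 ^ 19 * d ^ 2 := by positivity
    obtain ⟨q, hq⟩ : ∃ q : ℝ, q = Module.finrank ℝ V / (2 ^ 19 * d ^ 2) := ⟨_, rfl⟩
    have hq1 : 1 ≤ q := by rwa [hq, one_le_div hd0]
    have hfq : q * (2 ^ 19 * d ^ 2) = Module.finrank ℝ V := by rw [hq]; field_simp
    have hk : 1 ≤ ⌊q⌋₊ := Nat.le_floor (by simpa using hq1)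
    have hkq : (⌊q⌋₊ : ℝ) ≤ q := Nat.floor_le (by linarith)
    have hk1 : (1 : ℝ) ≤ ⌊q⌋₊ := by exact_mod_cast hk
    have hqk : q ≤ 2 * ⌊q⌋₊ := by linarith [Nat.lt_floor_add_one q]
    obtain ⟨N', h1, h2⟩ := hN.exists_isRound_five hd hk (by rw [← hfq]; nlinarith)
    exact ⟨_, N', by rw [← hfq]; nlinarith, h1, h2⟩
  · have : Nontrivial V := Module.finrank_pos_iff.1 hV
    obtain ⟨N', h1, h2⟩ := hN.exists_isRound_one
    exact ⟨1, N', by push_cast; nlinarith, h1, h2.mono (by norm_num)⟩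

end RoundSubquotients

section ConvexBodies

open scoped Topology

/-- The gauge of a symmetric convex body. -/
lemma exists_seminorm_of_convexBody {V : Type*} [NormedAddCommGroup V] [NormedSpace ℝ V]
    {K : Set V} (hconv : Convex ℝ K) (hcomp : IsCompact K) (hint : (interior K).Nonempty)
    (hsymm : ∀ x ∈ K, -x ∈ K) :
    ∃ N : Seminorm ℝ V, (∀ x, N x ≤ 1 ↔ x ∈ K) ∧ ∃ c : ℝ, 0 < c ∧ ∀ x, c * ‖x‖ ≤ N x := by
  have h0 : K ∈ 𝓝 0 := by
    obtain ⟨x, hx⟩ := hint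
    have := hconv.combo_interior_self_mem_interior hx (hsymm x (interior_subset hx))
      (a := 1 / 2) (b := 1 / 2) (by norm_num) (by norm_num) (by norm_num)
    rw [smul_neg, add_neg_cancel] at this
    exact mem_interior_iff_mem_nhds.1 this
  have hbal : Balanced ℝ K := by
    refine balanced_iff_smul_mem.2 fun a ha x hx ↦ ?_
    rw [Real.norm_eq_abs, abs_le] at ha
    have := hconv hx (hsymm x hx) (a := (1 + a) / 2) (b := (1 - a) / 2) (by linarith) (by linarith)
      (by ring)
    convert this using 1
    module
  have habs : Absorbent ℝ K := absorbent_nhds_zero h0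
  refine ⟨gaugeSeminorm hbal hconv habs, fun x ↦ ?_, ?_⟩
  · rw [gaugeSeminorm_toFun, gauge_le_one_iff_mem_closure hconv h0, hcomp.isClosed.closure_eq]
  · obtain ⟨r, hr, hK⟩ := hcomp.isBounded.subset_closedBall_lt 0 (0 : V)
    refine ⟨r⁻¹, by positivity, fun x ↦ ?_⟩
    rw [gaugeSeminorm_toFun, ← div_eq_inv_mul]
    exact le_gauge_of_subset_closedBall habs hr.le hK

lemma exists_ellipsoid_of_isSubquotient {V : Type*} [AddCommGroup V] [Module ℝ V]
    {N : Seminorm ℝ V} {K : Set V} (hK : ∀ x, N x ≤ 1 ↔ x ∈ K) {k : ℕ}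
    {M : Seminorm ℝ (EuclideanSpace ℝ (Fin k))} (hNM : IsSubquotient N M) {d : ℝ} (hd : 0 < d)
    (hM : M.IsRound d) :
    ∃ (W : Submodule ℝ V) (U : Submodule ℝ (V ⧸ W)), Module.finrank ℝ U = k ∧
      ∃ E₀ : Set ↥U, IsEllipsoid E₀ ∧ E₀ ⊆ ((↑) ⁻¹' (W.mkQ '' K) : Set ↥U) ∧
        ((↑) ⁻¹' (W.mkQ '' K) : Set ↥U) ⊆ d • E₀ := by
  obtain ⟨F, π, h1, h2⟩ := hNM
  obtain ⟨c, hc, hM⟩ := hM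
  obtain ⟨g, hg⟩ := LinearMap.exists_rightInverse_of_surjective (π.domRestrict F)
    (LinearMap.range_eq_top.2 fun y ↦ by
      obtain ⟨x, hx, hxy, -⟩ := h2 y
      exact ⟨⟨x, hx⟩, hxy⟩)
  have hg' : ∀ y, π (g y) = y := fun y ↦ LinearMap.congr_fun hg y
  obtain ⟨W, hW⟩ : ∃ W, W = F ⊓ LinearMap.ker π := ⟨_, rfl⟩
  have hgW : ∀ f ∈ F, W.mkQ (g (π f)) = W.mkQ f := by
    intro f hf
    rw [← sub_eq_zero, ← map_sub, Submodule.mkQ_apply, Submodule.Quotient.mk_eq_zero, hW]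
    exact ⟨F.sub_mem (g _).2 hf, by simp [hg']⟩
  let L : EuclideanSpace ℝ (Fin k) →ₗ[ℝ] F.map W.mkQ :=
    (W.mkQ ∘ₗ F.subtype ∘ₗ g).codRestrict _ fun y ↦ Submodule.mem_map_of_mem (g y).2
  have hL : ∀ y, (L y : V ⧸ W) = W.mkQ (g y) := fun y ↦ rfl
  have hLbij : Function.Bijective L := by
    constructor
    · refine (injective_iff_map_eq_zero L).2 fun y hy ↦ ?_
      have : W.mkQ (g y) = 0 := by rw [← hL, hy, Submodule.coe_zero]
      rw [Submodule.mkQ_apply, Submodule.Quotient.mk_eq_zero, hW] at this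
      rw [← hg' y]
      exact this.2
    · rintro ⟨-, f, hf, rfl⟩
      exact ⟨π f, Subtype.ext (by rw [hL, hgW f hf])⟩
  have hr : (d * c)⁻¹ ≠ 0 := by positivity
  refine ⟨W, F.map W.mkQ, ?_, ((d * c)⁻¹ • L) '' Metric.closedBall 0 1, ⟨k, _, ?_, rfl⟩, ?_, ?_⟩
  · rw [← (LinearEquiv.ofBijective L hLbij).finrank_eq, finrank_euclideanSpace_fin]
  · exact (MulAction.bijective (Units.mk0 _ hr)).comp hLbij
  · rintro - ⟨y, hy, rfl⟩
    rw [mem_closedBall_zero_iff] at hy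
    obtain ⟨f, hf, hfy, hfN⟩ := h2 ((d * c)⁻¹ • y)
    refine ⟨f, (hK f).1 (hfN.trans ((hM _).2.trans ?_)), ?_⟩
    · rw [norm_smul, norm_inv, Real.norm_of_nonneg (by positivity)]
      calc c * d * ((d * c)⁻¹ * ‖y‖) = ‖y‖ := by field_simp
        _ ≤ 1 := hy
    · rw [LinearMap.smul_apply, ← map_smul, hL, ← hfy, hgW f hf]
  · rintro ⟨-, f, hf, rfl⟩ ⟨x, hx, hxf⟩
    have hxF : x ∈ F := by
      have h3 : x - f ∈ W := by
        rw [← Submodule.Quotient.mk_eq_zero, ← Submodule.mkQ_apply, map_sub, sub_eq_zero]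
        exact hxf
      rw [hW] at h3
      simpa using F.add_mem h3.1 hf
    have hπx : c * ‖π x‖ ≤ 1 := (hM _).1.trans ((h1 x hxF).trans ((hK x).2 hx))
    refine ⟨_, ⟨c • π x, ?_, rfl⟩, Subtype.ext ?_⟩
    · rw [mem_closedBall_zero_iff, norm_smul, Real.norm_of_nonneg hc.le]
      exact hπx
    · dsimp only
      rw [LinearMap.smul_apply, map_smul, smul_smul, smul_smul,
        show d * (d * c)⁻¹ * c = 1 by field_simp, one_smul, hL, hgW x hxF]
      exact hxf

end ConvexBodies

lemma sq_polylog_le {t : ℝ} (ht : 1 / 2 ≤ t) :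
    (2 ^ 50 * (1 + Real.log (2 ^ 50 * (1 + 2 * t) ^ 3)) ^ 3) ^ 2 ≤ 2 ^ 140 * t := by
  obtain ⟨z, hz⟩ : ∃ z : ℝ, z = (1 + 2 * t) ^ (1 / 6 : ℝ) := ⟨_, rfl⟩
  have hz1 : 1 ≤ z := by
    rw [hz]
    exact Real.one_le_rpow (by linarith) (by norm_num)
  have hz6 : z ^ 6 = 1 + 2 * t := by
    rw [hz, ← Real.rpow_natCast, ← Real.rpow_mul (by linarith)]
    norm_num
  have hlog : Real.log (2 ^ 50 * (1 + 2 * t) ^ 3) = 50 * Real.log 2 + 18 * Real.log z := by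
    rw [← hz6, Real.log_mul (by norm_num) (by positivity), Real.log_pow, Real.log_pow,
      Real.log_pow]
    push_cast
    ring
  have h1 := Real.log_two_lt_d9
  have h2 := Real.log_le_sub_one_of_pos (show 0 < z by linarith)
  have h3 := Real.log_nonneg hz1
  have h4 := Real.log_nonneg one_le_two
  have h5 : 1 + Real.log (2 ^ 50 * (1 + 2 * t) ^ 3) ≤ 64 * z := by
    rw [hlog]
    linarith
  calc (2 ^ 50 * (1 + Real.log (2 ^ 50 * (1 + 2 * t) ^ 3)) ^ 3) ^ 2
    _ ≤ (2 ^ 50 * (64 * z) ^ 3) ^ 2 := by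
      have : 0 ≤ 1 + Real.log (2 ^ 50 * (1 + 2 * t) ^ 3) := by rw [hlog]; positivity
      gcongr
    _ = 2 ^ 136 * (1 + 2 * t) := by rw [← hz6]; ring
    _ ≤ 2 ^ 140 * t := by linarith

/-- There is a constant `C > 0` such that every `n`-dimensional symmetric convex body (`n ≥ 2`)
admits a subquotient (a slice `K₀` of a projection) of dimension at least `C·n/log n` which is
`256`-round, i.e. `E₀ ⊆ K₀ ⊆ 256·E₀` for some ellipsoid `E₀`. -/
theorem exists_round_subquotient_of_dim_n_div_log_n :
    ∃ C : ℝ, 0 < C ∧ ∀ n : ℕ, 2 ≤ n →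
      ∀ K : Set (EuclideanSpace ℝ (Fin n)),
        Convex ℝ K → IsCompact K → (interior K).Nonempty → (∀ x ∈ K, -x ∈ K) →
        ∃ (W : Submodule ℝ (EuclideanSpace ℝ (Fin n)))
          (U : Submodule ℝ (EuclideanSpace ℝ (Fin n) ⧸ W)),
          C * n / Real.log n ≤ (Module.finrank ℝ U : ℝ) ∧
          ∃ E₀ : Set ↥U, IsEllipsoid E₀ ∧
            E₀ ⊆ ((↑) ⁻¹' (W.mkQ '' K) : Set ↥U) ∧
            ((↑) ⁻¹' (W.mkQ '' K) : Set ↥U) ⊆ (256 : ℝ) • E₀ := by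
  refine ⟨(2 ^ 164)⁻¹, by positivity, fun n hn K hconv hcomp hint hsymm ↦ ?_⟩
  have hn2 : (2 : ℝ) ≤ n := by exact_mod_cast hn
  have hlogn : 1 / 2 ≤ Real.log n := by
    have := Real.log_le_log two_pos hn2
    linarith [Real.log_two_gt_d9]
  obtain ⟨N, hNK, c, hc, hN⟩ := exists_seminorm_of_convexBody hconv hcomp hint hsymm
  obtain ⟨N₁, hN₁, hr₁⟩ := exists_isRound_sq (by lia) N hc hN
  obtain ⟨k₂, N₂, hk₂, hN₂, hr₂⟩ := hr₁.exists_polylog (by lia) (by nlinarith)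
  rw [Real.log_pow, Nat.cast_ofNat] at hr₂
  have hone : 1 ≤ (1 + 2 * Real.log n) ^ 3 := one_le_pow₀ (by linarith)
  obtain ⟨k₃, N₃, hk₃, hN₃, hr₃⟩ := hr₂.exists_polylog (by lia) (by linarith)
  have hlog₃ : 0 ≤ Real.log (2 ^ 50 * (1 + 2 * Real.log n) ^ 3) := Real.log_nonneg (by linarith)
  have hone₃ : 1 ≤ (1 + Real.log (2 ^ 50 * (1 + 2 * Real.log n) ^ 3)) ^ 3 :=
    one_le_pow₀ (by linarith)
  obtain ⟨k, M, hk, hM, hr⟩ := hr₃.exists_isRound_five_of_finrank_pos (by linarith)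
    (by rw [finrank_euclideanSpace_fin]; lia)
  rw [finrank_euclideanSpace_fin] at hk
  obtain ⟨W, U, hU, h⟩ := exists_ellipsoid_of_isSubquotient hNK
    (((hN₁.trans hN₂).trans hN₃).trans hM) (by norm_num : (0 : ℝ) < 256) (hr.mono (by norm_num))
  refine ⟨W, U, ?_, h⟩
  rw [hU, div_le_iff₀ (by linarith), inv_mul_le_iff₀ (by positivity)]
  have hnk : (n : ℝ) ≤ 16 * k₃ := by exact_mod_cast (by lia : n ≤ 16 * k₃)
  have hpoly := mul_le_mul_of_nonneg_right (sq_polylog_le hlogn) (Nat.cast_nonneg (α := ℝ) k)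
  linarith
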